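/- Let M > 0 and let A_N, B_N be (M,0)-regular sequences of normal matrices with limit moments Φ, Ψ. Suppose there is R > 0 such that I_N(z;A_N,B_N) ≠ 0 for all z with |z| < R and all N ≥ 1, and set r = min(R, (2/27)·M^{−2}). For each N let F_N be the unique free-energy branch for I_N(·;A_N,B_N) on D(0,r). Then F_N converges to C_0(z;Φ,Ψ) = Σ_{d=1}^∞ C_{0,d}(Φ,Ψ) z^d/d! uniformly on every compact subset of the open disc D(0,r). -/

import Mathlib

open MeasureTheory Matrix

namespace HCIZ

noncomputable instance (N : ℕ) : MeasurableSpace (Matrix (Fin N) (Fin N) ℂ) := borel _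

instance (N : ℕ) : BorelSpace (Matrix (Fin N) (Fin N) ℂ) := ⟨rfl⟩

/-- The number of cycles of a permutation (fixed points counted as cycles). -/
def cycleCount {d : ℕ} (π : Equiv.Perm (Fin d)) : ℕ := π.partition.parts.card

/-- `π` has cycle type `α` (1-cycles included). -/
def HasCycleType {d : ℕ} (π : Equiv.Perm (Fin d)) (α : d.Partition) : Prop :=
  π.partition.parts = α.parts

/-- The tuple `τ` consists of transpositions `(s_i t_i)`, `s_i < t_i`, with
`t_1 ≤ t_2 ≤ ⋯` (monotone condition). -/
def IsMonotoneTuple {d r : ℕ} (τ : Fin r → Equiv.Perm (Fin d)) : Prop :=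
  (∀ i, (τ i).IsSwap) ∧ Monotone fun i => (τ i).support.max

/-- The subgroup generated by `s` acts transitively on `Fin d`. -/
def GeneratesTransitively {d : ℕ} (s : Set (Equiv.Perm (Fin d))) : Prop :=
  ∀ x y : Fin d, ∃ g ∈ Subgroup.closure s, g x = y

/-- `H⃗^r(α,β)`: the number of monotone transitive factorizations of the identity
into `ρ σ τ_1 ⋯ τ_r` with `ρ` of cycle type `α` and `σ` of cycle type `β`. -/
noncomputable def Hr (d : ℕ) (α β : d.Partition) (r : ℕ) : ℕ :=
  Nat.card {T : Equiv.Perm (Fin d) × Equiv.Perm (Fin d) × (Fin r → Equiv.Perm (Fin d)) //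
    HasCycleType T.1 α ∧ HasCycleType T.2.1 β ∧ IsMonotoneTuple T.2.2 ∧
    T.1 * T.2.1 * (List.ofFn T.2.2).prod = 1 ∧
    GeneratesTransitively ({T.1, T.2.1} ∪ Set.range T.2.2)}

/-- `H̃^r(α,β)`: the same count without the transitivity requirement. -/
noncomputable def Hnt (d : ℕ) (α β : d.Partition) (r : ℕ) : ℕ :=
  Nat.card {T : Equiv.Perm (Fin d) × Equiv.Perm (Fin d) × (Fin r → Equiv.Perm (Fin d)) //
    HasCycleType T.1 α ∧ HasCycleType T.2.1 β ∧ IsMonotoneTuple T.2.2 ∧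
    T.1 * T.2.1 * (List.ofFn T.2.2).prod = 1}

/-- The monotone double Hurwitz number `H⃗_g(α,β) = H⃗^r(α,β)`,
`r = 2g - 2 + ℓ(α) + ℓ(β)`. -/
noncomputable def Hg (d g : ℕ) (α β : d.Partition) : ℕ :=
  Hr d α β (2 * g + α.parts.card + β.parts.card - 2)

/-- `m_r(π)`: monotone (not necessarily transitive) factorizations of `π`
into `r` transpositions. -/
noncomputable def mcount (d r : ℕ) (π : Equiv.Perm (Fin d)) : ℕ :=
  Nat.card {τ : Fin r → Equiv.Perm (Fin d) //
    IsMonotoneTuple τ ∧ (List.ofFn τ).prod = π}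

/-- Power sum `p_α(A) = ∏ Tr(A^{α_i})`. -/
noncomputable def pPoly {N : ℕ} (A : Matrix (Fin N) (Fin N) ℂ) {d : ℕ} (α : d.Partition) : ℂ :=
  (α.parts.map fun k => (A ^ k).trace).prod

/-- `φ_α = ∏ φ_{α_i}`. -/
noncomputable def momProd (Φ : ℕ → ℂ) {d : ℕ} (α : d.Partition) : ℂ :=
  (α.parts.map Φ).prod

/-- `C_{g,d}(A,B) = ∑_{α,β ⊢ d} (-1)^{d+ℓ(α)+ℓ(β)} H⃗_g(α,β)
(N^{-ℓ(α)} p_α(A)) (N^{-ℓ(β)} p_β(B))`. -/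
noncomputable def Cmat {N : ℕ} (g d : ℕ) (A B : Matrix (Fin N) (Fin N) ℂ) : ℂ :=
  ∑ α : d.Partition, ∑ β : d.Partition,
    (-1 : ℂ) ^ (d + α.parts.card + β.parts.card) * (Hg d g α β : ℂ) *
      (((N : ℂ) ^ α.parts.card)⁻¹ * pPoly A α) * (((N : ℂ) ^ β.parts.card)⁻¹ * pPoly B β)

/-- `C_{g,d}(Φ,Ψ) = ∑_{α,β ⊢ d} (-1)^{d+ℓ(α)+ℓ(β)} H⃗_g(α,β) φ_α ψ_β`. -/
noncomputable def Cseq (g d : ℕ) (Φ Ψ : ℕ → ℂ) : ℂ :=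
  ∑ α : d.Partition, ∑ β : d.Partition,
    (-1 : ℂ) ^ (d + α.parts.card + β.parts.card) * (Hg d g α β : ℂ) *
      momProd Φ α * momProd Ψ β

/-- The HCIZ integral `I_N(z;A,B)` with respect to a measure `μ` on `U(N)`. -/
noncomputable def hciz {N : ℕ} (μ : Measure (Matrix.unitaryGroup (Fin N) ℂ))
    (A B : Matrix (Fin N) (Fin N) ℂ) (z : ℂ) : ℂ :=
  ∫ U : Matrix.unitaryGroup (Fin N) ℂ,
    Complex.exp (-(z * (N : ℂ) *
      (A * (U : Matrix (Fin N) (Fin N) ℂ) * B *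
        ((U⁻¹ : Matrix.unitaryGroup (Fin N) ℂ) : Matrix (Fin N) (Fin N) ℂ)).trace)) ∂μ

/-- A free-energy branch for `I_N(·;A,B)` on the disc `D(0,ε)`: a holomorphic
function `F` with `F 0 = 0` and `exp (N² F z) = I_N(z;A,B)` on the disc. -/
def IsFreeEnergyBranch {N : ℕ} (μ : Measure (Matrix.unitaryGroup (Fin N) ℂ))
    (A B : Matrix (Fin N) (Fin N) ℂ) (ε : ℝ) (F : ℂ → ℂ) : Prop :=
  DifferentiableOn ℂ F (Metric.ball 0 ε) ∧ F 0 = 0 ∧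
    ∀ z ∈ Metric.ball (0 : ℂ) ε, Complex.exp ((N : ℂ) ^ 2 * F z) = hciz μ A B z

/-- The L² operator norm of a matrix. -/
noncomputable def opNorm {N : ℕ} (A : Matrix (Fin N) (Fin N) ℂ) : ℝ :=
  ‖Matrix.toEuclideanCLM (𝕜 := ℂ) A‖

/-- The all-ones partition `(1^d)`. -/
def onesPartition (d : ℕ) : d.Partition :=
  ⟨Multiset.replicate d 1, fun {i} hi => by
    rw [Multiset.eq_of_mem_replicate hi]; exact one_pos, by simp⟩

/-- The partition `(2,1^{d-2})` of `d`, for `d ≥ 2`. -/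
def twoOnesPartition (d : ℕ) (hd : 2 ≤ d) : d.Partition :=
  ⟨2 ::ₘ Multiset.replicate (d - 2) 1, fun {i} hi => by
    rcases Multiset.mem_cons.mp hi with h | h
    · omega
    · rw [Multiset.eq_of_mem_replicate h]; exact one_pos, by
    simp [Multiset.sum_cons]; omega⟩


/-- `C_0(z;Φ,Ψ) = ∑_{d ≥ 1} C_{0,d}(Φ,Ψ) z^d/d!`, the generating function for
genus zero monotone double Hurwitz numbers. -/
noncomputable def C0fun (Φ Ψ : ℕ → ℂ) (z : ℂ) : ℂ :=
  ∑' d : ℕ, Cseq 0 (d + 1) Φ Ψ * z ^ (d + 1) / ((d + 1).factorial : ℂ)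

/-- The product of the transpositions `(a b)`, `a ∈ l`, in the order of the list. -/
def swapProd {α : Type*} [DecidableEq α] (b : α) (l : List α) : Equiv.Perm α :=
  (l.map fun a => Equiv.swap a b).prod

/-- The ordered product over `b ∈ e` of the transpositions `(a b)`, `a ∈ L b`. -/
def famProd {α : Type*} [DecidableEq α] (e : List α) (L : α → List α) : Equiv.Perm α :=
  (e.map fun b => swapProd b (L b)).prod

/-- The multiplicative weight of a word. -/
def listWt {α : Type*} (u : α → ℂ) (l : List α) : ℂ := (l.map u).prod

/-- The multiplicative weight of a family of words. -/
def famWt {α : Type*} [Fintype α] (y : α → α → ℂ) (L : α → List α) : ℂ :=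
  ∏ b, listWt (fun a => y a b) (L b)

lemma norm_listWt {α : Type*} (u : α → ℂ) (l : List α) :
    ‖listWt u l‖ = (l.map fun a => ‖u a‖).prod := by
  induction l with
  | nil => simp [listWt]
  | cons a l ih => simpa [listWt] using Or.inl ih

lemma summable_norm_listWt {α : Type*} [Fintype α] (u : α → ℂ) (h : ∑ a, ‖u a‖ < 1) :
    Summable fun l : List α => ‖listWt u l‖ := by
  rw [← List.equivSigmaTuple.symm.summable_iff]
  have key : ∀ (n : ℕ) (f : Fin n → α),
      ((fun l : List α => ‖listWt u l‖) ∘ List.equivSigmaTuple.symm) ⟨n, f⟩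
        = ∏ i, ‖u (f i)‖ := by
    intro n f
    simp [norm_listWt, List.equivSigmaTuple, List.map_ofFn, List.prod_ofFn]
  refine (summable_sigma_of_nonneg fun x => norm_nonneg (listWt u _)).mpr ⟨fun n => Summable.of_finite, ?_⟩
  have h2 : ∀ n : ℕ, (∑' f : Fin n → α,
      ((fun l : List α => ‖listWt u l‖) ∘ List.equivSigmaTuple.symm) ⟨n, f⟩)
        = (∑ a, ‖u a‖) ^ n := by
    intro n
    rw [tsum_fintype, Fintype.sum_pow]
    exact Finset.sum_congr rfl fun f _ => key n f
  refine Summable.congr ?_ fun n => (h2 n).symm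
  exact summable_geometric_of_lt_one (Finset.sum_nonneg fun _ _ => norm_nonneg _) h

lemma exists_norm_bound {β : Type*} [Finite β] (f : β → ℂ) : ∃ C : ℝ, 0 ≤ C ∧ ∀ x, ‖f x‖ ≤ C := by
  have := Fintype.ofFinite β
  exact ⟨∑ x, ‖f x‖, Finset.sum_nonneg fun _ _ => norm_nonneg _, fun x =>
    Finset.single_le_sum (f := fun x => ‖f x‖) (fun _ _ => norm_nonneg _) (Finset.mem_univ x)⟩

lemma summable_mul_comp_finite {ι β : Type*} [Finite β] (w : ι → ℂ) (hw : Summable fun i => ‖w i‖)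
    (f : β → ℂ) (p : ι → β) : Summable fun i => w i * f (p i) := by
  obtain ⟨C, hC, hf⟩ := exists_norm_bound f
  refine Summable.of_norm_bounded (hw.mul_right C) fun i => ?_
  rw [norm_mul]
  exact mul_le_mul_of_nonneg_left (hf _) (norm_nonneg _)

/-- The resolvent of the weighted sum of transpositions `(a b)`, acting by right translation. -/
noncomputable def resolvent {α : Type*} [DecidableEq α] (u : α → ℂ) (b : α)
    (f : Equiv.Perm α → ℂ) (g : Equiv.Perm α) : ℂ :=
  ∑' l : List α, listWt u l * f (g * swapProd b l)

/-- Lists are either empty or have a head and a tail. -/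
def listEquivSum (α : Type*) : List α ≃ Unit ⊕ (α × List α) where
  toFun l := match l with
    | [] => Sum.inl ()
    | a :: l => Sum.inr (a, l)
  invFun s := match s with
    | Sum.inl _ => []
    | Sum.inr (a, l) => a :: l
  left_inv l := by cases l <;> rfl
  right_inv s := by rcases s with _ | ⟨_, _⟩ <;> rfl

lemma resolvent_eq {α : Type*} [Fintype α] [DecidableEq α] (u : α → ℂ) (h : ∑ a, ‖u a‖ < 1)
    (b : α) (f : Equiv.Perm α → ℂ) (g : Equiv.Perm α) :
    resolvent u b f g = f g + ∑ a, u a * resolvent u b f (g * Equiv.swap a b) := by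
  have hs : ∀ g, Summable fun l : List α => listWt u l * f (g * swapProd b l) := fun g =>
    summable_mul_comp_finite _ (summable_norm_listWt u h) f _
  set F : List α → ℂ := fun l => listWt u l * f (g * swapProd b l) with hF
  have h1 : ∑' l, F l = ∑' s, F ((listEquivSum α).symm s) :=
    ((listEquivSum α).symm.tsum_eq F).symm
  have hs2 : Summable fun s => F ((listEquivSum α).symm s) :=
    (listEquivSum α).symm.summable_iff.mpr (hs g)
  have hs3 : Summable fun p : α × List α => F (p.1 :: p.2) :=
    hs2.comp_injective (i := Sum.inr) Sum.inr_injective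
  have h4 : ∑' s, F ((listEquivSum α).symm s) =
      ∑' s, F ((listEquivSum α).symm (Sum.inl s)) + ∑' p, F ((listEquivSum α).symm (Sum.inr p)) :=
    Summable.tsum_sum (f := fun s => F ((listEquivSum α).symm s)) Summable.of_finite hs3
  have h5 : ∑' p, F ((listEquivSum α).symm (Sum.inr p)) = ∑' p : α × List α, F (p.1 :: p.2) := rfl
  have h6 : ∑' s : Unit, F ((listEquivSum α).symm (Sum.inl s)) = f g := by
    rw [tsum_fintype]
    simp [hF, listEquivSum, listWt, swapProd]
  have h7 : ∑' p : α × List α, F (p.1 :: p.2) = ∑ a, ∑' l, F (a :: l) := by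
    rw [hs3.tsum_prod, tsum_fintype]
  have h8 : ∀ a, ∑' l, F (a :: l) = u a * resolvent u b f (g * Equiv.swap a b) := by
    intro a
    rw [resolvent, ← tsum_mul_left]
    refine tsum_congr fun l => ?_
    simp only [hF, listWt, swapProd, List.map_cons, List.prod_cons, mul_assoc]
  calc resolvent u b f g = ∑' l, F l := rfl
    _ = _ := by rw [h1, h4, h5, h6, h7, Finset.sum_congr rfl fun a _ => h8 a]

/-- Families of words that are empty outside `e`. -/
abbrev Fam {α : Type*} (e : List α) := {L : α → List α // ∀ b, b ∉ e → L b = []}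

/-- Splitting off the first word of a family. -/
def famCons {α : Type*} [DecidableEq α] (b : α) (e : List α) (hb : b ∉ e) :
    List α × Fam e ≃ Fam (b :: e) where
  toFun p := ⟨Function.update p.2.1 b p.1, fun c hc => by
    simp only [List.mem_cons, not_or] at hc
    rw [Function.update_of_ne hc.1, p.2.2 c hc.2]⟩
  invFun L := (L.1 b, ⟨Function.update L.1 b [], fun c hc => by
    by_cases h : c = b
    · subst h; simp
    · rw [Function.update_of_ne h]; exact L.2 c (by simp [h, hc])⟩)
  left_inv p := by
    ext1
    · simp
    · apply Subtype.ext
      simp [p.2.2 b hb, Function.update_eq_self_iff]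
  right_inv L := by
    apply Subtype.ext
    simp

/-- The weight of a family of words along a list. -/
def famWtOn {α : Type*} (y : α → α → ℂ) (e : List α) (L : α → List α) : ℂ :=
  (e.map fun b => listWt (fun a => y a b) (L b)).prod

lemma famWtOn_update {α : Type*} [DecidableEq α] (y : α → α → ℂ) (e : List α) (L : α → List α)
    (b : α) (hb : b ∉ e) (l : List α) :
    famWtOn y e (Function.update L b l) = famWtOn y e L := by
  unfold famWtOn
  congr 1
  refine List.map_congr_left fun c hc => ?_
  rw [Function.update_of_ne (by rintro rfl; exact hb hc)]

lemma famProd_update {α : Type*} [DecidableEq α] (e : List α) (L : α → List α)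
    (b : α) (hb : b ∉ e) (l : List α) :
    famProd e (Function.update L b l) = famProd e L := by
  unfold famProd
  congr 1
  refine List.map_congr_left fun c hc => ?_
  rw [Function.update_of_ne (by rintro rfl; exact hb hc)]

lemma famWtOn_cons_famCons {α : Type*} [DecidableEq α] (y : α → α → ℂ) (b : α) (e : List α)
    (hb : b ∉ e) (p : List α × Fam e) :
    famWtOn y (b :: e) (famCons b e hb p).1 = listWt (fun a => y a b) p.1 * famWtOn y e p.2.1 := by
  have : famWtOn y (b :: e) (famCons b e hb p).1 =
      listWt (fun a => y a b) (Function.update p.2.1 b p.1 b) *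
        famWtOn y e (Function.update p.2.1 b p.1) := by
    simp [famWtOn, famCons]
  rw [this, famWtOn_update _ _ _ _ hb, Function.update_self]

lemma famProd_cons_famCons {α : Type*} [DecidableEq α] (b : α) (e : List α)
    (hb : b ∉ e) (p : List α × Fam e) :
    famProd (b :: e) (famCons b e hb p).1 = swapProd b p.1 * famProd e p.2.1 := by
  have : famProd (b :: e) (famCons b e hb p).1 =
      swapProd b (Function.update p.2.1 b p.1 b) *
        famProd e (Function.update p.2.1 b p.1) := by
    simp [famProd, famCons]
  rw [this, famProd_update _ _ _ hb, Function.update_self]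

lemma summable_norm_famWtOn {α : Type*} [Fintype α] [DecidableEq α] (y : α → α → ℂ)
    (h : ∀ b, ∑ a, ‖y a b‖ < 1) (e : List α) (he : e.Nodup) :
    Summable fun L : Fam e => ‖famWtOn y e L.1‖ := by
  induction e with
  | nil =>
    have : Subsingleton (Fam ([] : List α)) :=
      ⟨fun L L' => Subtype.ext (funext fun b => by rw [L.2 b (by simp), L'.2 b (by simp)])⟩
    exact Summable.of_finite
  | cons b e ih =>
    rw [List.nodup_cons] at he
    rw [← (famCons b e he.1).summable_iff]
    have := Summable.mul_of_nonneg (summable_norm_listWt (fun a => y a b) (h b)) (ih he.2)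
      (fun _ => norm_nonneg _) (fun _ => norm_nonneg _)
    refine this.congr fun p => ?_
    simp only [Function.comp, famWtOn_cons_famCons, norm_mul]

/-- The composition of resolvents along a list. -/
noncomputable def resolventList {α : Type*} [DecidableEq α] (y : α → α → ℂ) :
    List α → (Equiv.Perm α → ℂ) → (Equiv.Perm α → ℂ)
  | [], f => f
  | b :: e, f => resolvent (fun a => y a b) b (resolventList y e f)

lemma tsum_fam_eq_resolventList {α : Type*} [Fintype α] [DecidableEq α] (y : α → α → ℂ)
    (h : ∀ b, ∑ a, ‖y a b‖ < 1) (e : List α) (he : e.Nodup) (f : Equiv.Perm α → ℂ)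
    (g : Equiv.Perm α) :
    ∑' L : Fam e, famWtOn y e L.1 * f (g * famProd e L.1) = resolventList y e f g := by
  induction e generalizing g with
  | nil =>
    have : Unique (Fam ([] : List α)) :=
      { default := ⟨fun _ => [], fun _ _ => rfl⟩
        uniq := fun L => Subtype.ext (funext fun b => by rw [L.2 b (by simp)]) }
    rw [tsum_fintype, Fintype.sum_unique]
    simp [famWtOn, famProd, resolventList]
  | cons b e ih =>
    have hn := he
    rw [List.nodup_cons] at he
    have hs := summable_mul_comp_finite _ (summable_norm_famWtOn y h (b :: e) hn) f
      (fun L => g * famProd (b :: e) L.1)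
    rw [← (famCons b e he.1).tsum_eq]
    rw [← (famCons b e he.1).summable_iff] at hs
    refine (Summable.tsum_prod hs).trans ?_
    rw [resolventList, resolvent]
    refine tsum_congr fun l => ?_
    rw [← ih he.2, ← tsum_mul_left]
    refine tsum_congr fun L => ?_
    simp only [Function.comp]
    rw [famWtOn_cons_famCons, famProd_cons_famCons]
    simp only [mul_assoc]

/-- All families, as families supported on a complete list. -/
def famEquiv {α : Type*} (e : List α) (he : ∀ a, a ∈ e) : (α → List α) ≃ Fam e where
  toFun L := ⟨L, fun b hb => absurd (he b) hb⟩
  invFun L := L.1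
  left_inv _ := rfl
  right_inv _ := rfl

lemma famWtOn_eq_famWt {α : Type*} [Fintype α] [DecidableEq α] (y : α → α → ℂ) (e : List α)
    (hn : e.Nodup) (he : ∀ a, a ∈ e) (L : α → List α) : famWtOn y e L = famWt y L := by
  have : (Finset.univ : Finset α) = e.toFinset := by ext; simp [he]
  rw [famWt, this, List.prod_toFinset _ hn, famWtOn]

lemma summable_norm_famWt {α : Type*} [Fintype α] [DecidableEq α] (y : α → α → ℂ)
    (h : ∀ b, ∑ a, ‖y a b‖ < 1) : Summable fun L : α → List α => ‖famWt y L‖ := by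
  have hn := (Finset.univ : Finset α).nodup_toList
  have he : ∀ a, a ∈ (Finset.univ : Finset α).toList := by simp
  have := (famEquiv _ he).summable_iff.mpr (summable_norm_famWtOn y h _ hn)
  refine this.congr fun L => ?_
  simp [famEquiv, famWtOn_eq_famWt y _ hn he]

lemma tsum_famWt_eq_resolventList {α : Type*} [Fintype α] [DecidableEq α] (y : α → α → ℂ)
    (h : ∀ b, ∑ a, ‖y a b‖ < 1) (e : List α) (hn : e.Nodup) (he : ∀ a, a ∈ e)
    (f : Equiv.Perm α → ℂ) (g : Equiv.Perm α) :
    ∑' L : α → List α, famWt y L * f (g * famProd e L) = resolventList y e f g := by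
  rw [← tsum_fam_eq_resolventList y h e hn, ← (famEquiv e he).tsum_eq]
  refine tsum_congr fun L => ?_
  simp [famEquiv, famWtOn_eq_famWt y e hn he]

/-- The trace of `A^{⊗ α}` composed with the permutation operator of `π`. -/
noncomputable def permTr {α : Type*} [Fintype α] [DecidableEq α] {N : ℕ}
    (A : Matrix (Fin N) (Fin N) ℂ) (π : Equiv.Perm α) : ℂ :=
  ∑ i : α → Fin N, ∏ s, A (i s) (i (π s))

lemma permTr_mul_comm {α : Type*} [Fintype α] [DecidableEq α] {N : ℕ}
    (A : Matrix (Fin N) (Fin N) ℂ) (π σ : Equiv.Perm α) :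
    permTr A (π * σ) = permTr A (σ * π) := by
  unfold permTr
  rw [← (Equiv.arrowCongr σ.symm (Equiv.refl (Fin N))).sum_comp]
  refine Finset.sum_congr rfl fun i _ => ?_
  rw [← σ.symm.prod_comp]
  refine Finset.prod_congr rfl fun s _ => ?_
  simp [Equiv.arrowCongr]

/-- Colorings by `Fin N` that are constant on the orbits of `π` and equal to `z` off `S`. -/
abbrev InvColoring {α : Type*} {N : ℕ} (z : Fin N) (S : Finset α) (π : Equiv.Perm α) :=
  {i : α → Fin N // (∀ s, i (π s) = i s) ∧ ∀ s, s ∉ S → i s = z}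

open Classical in
/-- The number of invariant colorings of `S`, if `π` is supported in `S`, and zero otherwise. -/
noncomputable def colorCount {α : Type*} {N : ℕ} (z : Fin N) (S : Finset α)
    (π : Equiv.Perm α) : ℂ :=
  if ∀ s, s ∉ S → π s = s then (Nat.card (InvColoring z S π) : ℂ) else 0

lemma card_invColoring_of_fixed {α : Type*} [DecidableEq α] {N : ℕ} (z : Fin N) (S : Finset α)
    (b : α) (hb : b ∉ S) (π : Equiv.Perm α) (h : π b = b) :
    Nat.card (InvColoring z (insert b S) π) = N * Nat.card (InvColoring z S π) := by
  have hπ : ∀ s, s ≠ b → π s ≠ b := fun s hs h' => hs (π.injective (h'.trans h.symm))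
  have e : InvColoring z (insert b S) π ≃ Fin N × InvColoring z S π :=
    { toFun := fun i => (i.1 b, ⟨Function.update i.1 b z, by
        intro s
        by_cases hs : s = b
        · subst hs; rw [h]
        · rw [Function.update_of_ne (hπ s hs), Function.update_of_ne hs, i.2.1], by
        intro s hs
        by_cases hsb : s = b
        · subst hsb; simp
        · rw [Function.update_of_ne hsb]; exact i.2.2 s (by simp [hsb, hs])⟩)
      invFun := fun p => ⟨Function.update p.2.1 b p.1, by
        intro s
        by_cases hs : s = b
        · subst hs; rw [h]
        · rw [Function.update_of_ne (hπ s hs), Function.update_of_ne hs, p.2.2.1], by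
        intro s hs
        simp only [Finset.mem_insert, not_or] at hs
        rw [Function.update_of_ne hs.1]; exact p.2.2.2 s hs.2⟩
      left_inv := fun i => by
        apply Subtype.ext
        simp
      right_inv := fun p => by
        ext1
        · simp
        · apply Subtype.ext
          simp [Function.update_eq_self_iff, p.2.2.2 b hb] }
  rw [Nat.card_congr e, Nat.card_prod, Nat.card_fin]

lemma card_invColoring_of_moved {α : Type*} [DecidableEq α] {N : ℕ} (z : Fin N) (S : Finset α)
    (b : α) (hb : b ∉ S) (π : Equiv.Perm α) (h : π b ≠ b) :
    Nat.card (InvColoring z (insert b S) π) =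
      Nat.card (InvColoring z S (Equiv.swap (π b) b * π)) := by
  have hπ : ∀ s, s ≠ b → π s ≠ π b := fun s hs h' => hs (π.injective h')
  refine Nat.card_congr
    { toFun := fun i => ⟨Function.update i.1 b z, by
        intro s
        by_cases hs : s = b
        · subst hs; simp
        · rw [Equiv.Perm.mul_apply, Function.update_of_ne hs]
          by_cases hsb : π s = b
          · rw [hsb, Equiv.swap_apply_right, Function.update_of_ne h, i.2.1]
            have h1 := i.2.1 s
            rw [hsb] at h1
            exact h1
          · rw [Equiv.swap_apply_of_ne_of_ne (hπ s hs) hsb, Function.update_of_ne hsb, i.2.1], by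
        intro s hs
        by_cases hsb : s = b
        · subst hsb; simp
        · rw [Function.update_of_ne hsb]; exact i.2.2 s (by simp [hsb, hs])⟩
      invFun := fun j => ⟨Function.update j.1 b (j.1 (π b)), by
        intro s
        by_cases hs : s = b
        · subst hs; rw [Function.update_self, Function.update_of_ne h]
        · rw [Function.update_of_ne hs]
          have := j.2.1 s
          rw [Equiv.Perm.mul_apply] at this
          by_cases hsb : π s = b
          · rw [hsb, Equiv.swap_apply_right] at this
            rw [hsb, Function.update_self, this]
          · rw [Equiv.swap_apply_of_ne_of_ne (hπ s hs) hsb] at this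
            rw [Function.update_of_ne hsb, this], by
        intro s hs
        simp only [Finset.mem_insert, not_or] at hs
        rw [Function.update_of_ne hs.1]; exact j.2.2 s hs.2⟩
      left_inv := fun i => by
        apply Subtype.ext
        simp [Function.update_of_ne h, i.2.1]
      right_inv := fun j => by
        apply Subtype.ext
        simp [Function.update_eq_self_iff, j.2.2 b hb] }

lemma colorCount_insert {α : Type*} [DecidableEq α] {N : ℕ} (z : Fin N) (S : Finset α)
    (b : α) (hb : b ∉ S) (π : Equiv.Perm α) :
    colorCount z (insert b S) π =
      N * colorCount z S π + ∑ a ∈ S, colorCount z S (Equiv.swap a b * π) := by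
  by_cases H : ∀ s, s ∉ insert b S → π s = s
  · by_cases hfix : π b = b
    · have h1 : ∀ s, s ∉ S → π s = s := by
        intro s hs
        by_cases hsb : s = b
        · rw [hsb, hfix]
        · exact H s (by simp [hsb, hs])
      have h2 : ∀ a ∈ S, colorCount z S (Equiv.swap a b * π) = 0 := by
        intro a ha
        refine if_neg fun h => ?_
        have := h b hb
        rw [Equiv.Perm.mul_apply, hfix, Equiv.swap_apply_right] at this
        exact hb (this ▸ ha)
      rw [Finset.sum_eq_zero h2, colorCount, if_pos H, colorCount, if_pos h1,
        card_invColoring_of_fixed z S b hb π hfix]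
      push_cast; ring
    · have hmem : π b ∈ S := by
        by_contra hn
        have := H (π b) (by simp [hfix, hn])
        exact hfix (π.injective this)
      have h0 : colorCount z S π = 0 := if_neg fun h => hfix (h b hb)
      have h2 : ∀ a ∈ S, a ≠ π b → colorCount z S (Equiv.swap a b * π) = 0 := by
        intro a ha hne
        refine if_neg fun h => ?_
        have := h b hb
        rw [Equiv.Perm.mul_apply, Equiv.swap_apply_of_ne_of_ne hne.symm hfix] at this
        exact hfix this
      rw [h0, Finset.sum_eq_single (π b) h2 (fun h => absurd hmem h), colorCount, if_pos H,
        colorCount, if_pos, card_invColoring_of_moved z S b hb π hfix]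
      · ring
      · intro s hs
        rw [Equiv.Perm.mul_apply]
        by_cases hsb : s = b
        · rw [hsb, Equiv.swap_apply_left]
        · rw [H s (by simp [hsb, hs]), Equiv.swap_apply_of_ne_of_ne _ hsb]
          rintro rfl; exact hs hmem
  · have H' := H
    push Not at H'
    obtain ⟨s, hs, hne⟩ := H'
    simp only [Finset.mem_insert, not_or] at hs
    rw [colorCount, if_neg H, colorCount, if_neg (fun h => hne (h s hs.2)), Finset.sum_eq_zero]
    · simp
    · intro a ha
      refine if_neg fun h => hne ?_
      have := h s hs.2
      rw [Equiv.Perm.mul_apply] at this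
      have h3 := congrArg (Equiv.swap a b) this
      rw [Equiv.swap_apply_self, Equiv.swap_apply_of_ne_of_ne _ hs.1] at h3
      · exact h3
      · rintro rfl; exact hs.2 ha

/-- Convolution with the coloring count. -/
noncomputable def colorConv {α : Type*} [Fintype α] [DecidableEq α] {N : ℕ} (z : Fin N)
    (S : Finset α) (f : Equiv.Perm α → ℂ) (g : Equiv.Perm α) : ℂ :=
  ∑ π, colorCount z S π * f (g * π)

lemma colorConv_empty {α : Type*} [Fintype α] [DecidableEq α] {N : ℕ} (z : Fin N)
    (f : Equiv.Perm α → ℂ) (g : Equiv.Perm α) : colorConv z ∅ f g = f g := by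
  rw [colorConv, Finset.sum_eq_single 1]
  · have : Unique (InvColoring z ∅ (1 : Equiv.Perm α)) :=
      { default := ⟨fun _ => z, fun _ => rfl, fun _ _ => rfl⟩
        uniq := fun i => Subtype.ext (funext fun s => i.2.2 s (by simp)) }
    rw [colorCount, if_pos (show ∀ s, s ∉ (∅ : Finset α) → (1 : Equiv.Perm α) s = s from fun s _ => rfl), Nat.card_unique]
    simp
  · intro π _ hπ
    rw [colorCount, if_neg, zero_mul]
    exact fun h => hπ (Equiv.ext fun s => h s (by simp))
  · simp

lemma colorConv_insert {α : Type*} [Fintype α] [DecidableEq α] {N : ℕ} (z : Fin N)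
    (S : Finset α) (b : α) (hb : b ∉ S) (f : Equiv.Perm α → ℂ) (g : Equiv.Perm α) :
    colorConv z (insert b S) f g =
      N * colorConv z S f g + ∑ a ∈ S, colorConv z S f (g * Equiv.swap a b) := by
  simp only [colorConv, colorCount_insert z S b hb, add_mul, Finset.sum_add_distrib,
    Finset.sum_mul, Finset.mul_sum, mul_assoc]
  congr 1
  rw [Finset.sum_comm]
  refine Finset.sum_congr rfl fun a _ => ?_
  rw [← Equiv.sum_comp (Equiv.mulLeft (Equiv.swap a b))]
  refine Finset.sum_congr rfl fun π _ => ?_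
  simp [Equiv.swap_mul_self_mul]

lemma colorCount_univ {α : Type*} [Fintype α] [DecidableEq α] {N : ℕ} (z : Fin N)
    (π : Equiv.Perm α) :
    colorCount z Finset.univ π = permTr (1 : Matrix (Fin N) (Fin N) ℂ) π := by
  classical
  rw [colorCount, if_pos (by simp), permTr]
  have : ∀ i : α → Fin N, ∏ s, (1 : Matrix (Fin N) (Fin N) ℂ) (i s) (i (π s)) =
      if (∀ s, i (π s) = i s) then 1 else 0 := by
    intro i
    simp only [Matrix.one_apply]
    rw [Finset.prod_ite_zero]
    simp [eq_comm]
  simp_rw [this]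
  rw [Finset.sum_boole, Nat.card_eq_fintype_card, Fintype.card_subtype]
  simp

/-- The weight `x` on pairs which are increasing for `key`, and zero on all other pairs. -/
noncomputable def keyWt {α : Type*} (key : α → ℕ) (x : ℂ) (a b : α) : ℂ :=
  if key a < key b then x else 0

lemma sum_norm_keyWt_lt {α : Type*} [Fintype α] (key : α → ℕ) (x : ℂ)
    (h : Fintype.card α * ‖x‖ ≤ 1) (b : α) : ∑ a, ‖keyWt key x a b‖ < 1 := by
  classical
  rcases eq_or_ne x 0 with rfl | hx
  · simp [keyWt]
  · have : ∑ a, ‖keyWt key x a b‖ < ∑ _a : α, ‖x‖ := by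
      refine Finset.sum_lt_sum (fun a _ => ?_) ⟨b, Finset.mem_univ b, ?_⟩
      · unfold keyWt; split_ifs <;> simp
      · simp [keyWt, hx]
    refine this.trans_le ?_
    simpa using h

lemma colorConv_resolventList {α : Type*} [Fintype α] [DecidableEq α] {N : ℕ} (z : Fin N)
    (key : α → ℕ) (hN : Fintype.card α ≤ N) (e : List α)
    (he : e.Pairwise fun a b => key a < key b) (f h : Equiv.Perm α → ℂ) (S : Finset α) (c : ℂ)
    (hS : ∀ a ∈ S, ∀ b ∈ e, key a < key b) (hSe : ∀ a, a ∈ S ∨ a ∈ e)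
    (hh : ∀ g, colorConv z S h g = c * resolventList (keyWt key (-(N : ℂ)⁻¹)) e f g)
    (g : Equiv.Perm α) :
    colorConv z Finset.univ h g = c * N ^ e.length * f g := by
  have hN0 : (N : ℂ) ≠ 0 := by
    have := z.pos
    exact_mod_cast this.ne'
  induction e generalizing S c with
  | nil =>
    have : S = Finset.univ := by ext a; simpa using hSe a
    subst this
    simp [hh, resolventList]
  | cons b e ih =>
    rw [List.pairwise_cons] at he
    have hbS : b ∉ S := fun hb => lt_irrefl _ (hS b hb b (by simp))
    have key_iff : ∀ a, key a < key b ↔ a ∈ S := by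
      intro a
      refine ⟨fun hlt => ?_, fun ha => hS a ha b (by simp)⟩
      rcases hSe a with h | h
      · exact h
      · rcases List.mem_cons.mp h with rfl | h
        · exact absurd hlt (lt_irrefl _)
        · exact absurd hlt (he.1 a h).not_gt
    have hnorm : ∑ a, ‖keyWt key (-(N : ℂ)⁻¹) a b‖ < 1 := by
      refine sum_norm_keyWt_lt key _ ?_ b
      rw [norm_neg, norm_inv, Complex.norm_natCast]
      rw [← div_eq_mul_inv]
      exact div_le_one_of_le₀ (by exact_mod_cast hN) (Nat.cast_nonneg _)
    rw [ih he.2 (insert b S) (c * N)]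
    · rw [List.length_cons, pow_succ]; ring
    · intro a ha b' hb'
      rcases Finset.mem_insert.mp ha with rfl | ha
      · exact he.1 b' hb'
      · exact hS a ha b' (by simp [hb'])
    · intro a
      rcases hSe a with h | h
      · simp [h]
      · rcases List.mem_cons.mp h with rfl | h <;> simp [*]
    · intro g
      rw [colorConv_insert z S b hbS]
      simp only [hh, resolventList]
      rw [resolvent_eq _ hnorm]
      have : ∀ F : α → ℂ, ∑ a, keyWt key (-(N : ℂ)⁻¹) a b * F a =
          -(N : ℂ)⁻¹ * ∑ a ∈ S, F a := by
        intro F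
        simp only [keyWt, key_iff, ite_mul, zero_mul, Finset.mul_sum]
        rw [Finset.sum_ite_mem, Finset.univ_inter]
      rw [this, ← Finset.mul_sum]
      field_simp
      ring

lemma sum_permTr_one_mul {α : Type*} [Fintype α] [DecidableEq α] {N : ℕ} (hN0 : 0 < N)
    (key : α → ℕ) (hN : Fintype.card α ≤ N) (e : List α)
    (he : e.Pairwise fun a b => key a < key b) (hc : ∀ a, a ∈ e) (f : Equiv.Perm α → ℂ)
    (g : Equiv.Perm α) :
    ∑ π, permTr (1 : Matrix (Fin N) (Fin N) ℂ) π *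
      (∑' L : α → List α, famWt (keyWt key (-(N : ℂ)⁻¹)) L * f (g * π * famProd e L)) =
      N ^ Fintype.card α * f g := by
  have hn : e.Nodup := he.imp (fun h => by rintro rfl; exact lt_irrefl _ h)
  have hlen : e.length = Fintype.card α := by
    rw [← List.toFinset_card_of_nodup hn, ← Finset.card_univ]
    congr 1
    ext; simp [hc]
  have hnorm : ∀ b, ∑ a, ‖keyWt key (-(N : ℂ)⁻¹) a b‖ < 1 := by
    refine sum_norm_keyWt_lt key _ ?_
    rw [norm_neg, norm_inv, Complex.norm_natCast, ← div_eq_mul_inv]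
    exact div_le_one_of_le₀ (by exact_mod_cast hN) (Nat.cast_nonneg _)
  have := colorConv_resolventList (⟨0, hN0⟩ : Fin N) key hN e he f
    (resolventList (keyWt key (-(N : ℂ)⁻¹)) e f) ∅ 1 (by simp) (by simp [hc])
    (by simp [colorConv_empty]) g
  rw [one_mul, hlen] at this
  rw [← this, colorConv]
  refine Finset.sum_congr rfl fun π _ => ?_
  rw [colorCount_univ, tsum_famWt_eq_resolventList _ hnorm e hn hc]

/-- Matrix elements of the tensor power `V^{⊗ α}`. -/
def tens {α : Type*} [Fintype α] {N : ℕ} (V : Matrix (Fin N) (Fin N) ℂ)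
    (i j : α → Fin N) : ℂ := ∏ s, V (i s) (j s)

lemma tens_mul {α : Type*} [Fintype α] [DecidableEq α] {N : ℕ} (V W : Matrix (Fin N) (Fin N) ℂ)
    (i j : α → Fin N) : tens (V * W) i j = ∑ l, tens V i l * tens W l j := by
  simp only [tens, Matrix.mul_apply, ← Finset.prod_mul_distrib]
  rw [Finset.prod_univ_sum, Fintype.piFinset_univ]

lemma tens_comp {α : Type*} [Fintype α] {N : ℕ} (V : Matrix (Fin N) (Fin N) ℂ)
    (i j : α → Fin N) (σ : Equiv.Perm α) : tens V (i ∘ σ) (j ∘ σ) = tens V i j :=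
  Equiv.prod_comp σ fun s => V (i s) (j s)

lemma permTr_eq_tens {α : Type*} [Fintype α] [DecidableEq α] {N : ℕ}
    (A : Matrix (Fin N) (Fin N) ℂ) (π : Equiv.Perm α) : permTr A π = ∑ i, tens A i (i ∘ π) := rfl

lemma permTr_matrix_mul_comm {α : Type*} [Fintype α] [DecidableEq α] {N : ℕ}
    (V W : Matrix (Fin N) (Fin N) ℂ) (π : Equiv.Perm α) :
    permTr (V * W) π = permTr (W * V) π := by
  simp only [permTr_eq_tens, tens_mul]
  rw [Finset.sum_comm]
  refine Finset.sum_congr rfl fun l _ => ?_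
  rw [← Equiv.sum_comp (Equiv.arrowCongr π (Equiv.refl (Fin N)))]
  refine Finset.sum_congr rfl fun i _ => ?_
  have h : (Equiv.arrowCongr π (Equiv.refl (Fin N))) i ∘ π = i := by
    ext s; simp [Equiv.arrowCongr]
  rw [h, ← tens_comp V _ l π, h, mul_comm]

/-- The unitary group `U(N)` commutant condition for an operator on tensors. -/
def CommutesTens {α : Type*} [Fintype α] [DecidableEq α] {N : ℕ}
    (T : (α → Fin N) → (α → Fin N) → ℂ) : Prop :=
  ∀ V ∈ Matrix.unitaryGroup (Fin N) ℂ, ∀ i j,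
    ∑ l, tens V i l * T l j = ∑ l, T i l * tens V l j

lemma commutesTens_perm {α : Type*} [Fintype α] [DecidableEq α] {N : ℕ} (σ : Equiv.Perm α) :
    CommutesTens fun i j : α → Fin N => if i = j ∘ σ then (1 : ℂ) else 0 := by
  intro V _ i j
  have h : ∀ l : α → Fin N, (i = l ∘ σ) ↔ l = i ∘ σ.symm := fun l =>
    ⟨fun h => by ext s; simp [h], fun h => by ext s; simp [h]⟩
  simp only [h, mul_ite, mul_one, mul_zero, ite_mul, one_mul, zero_mul, Finset.sum_ite_eq',
    Finset.mem_univ, if_true]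
  rw [← tens_comp V (i ∘ σ.symm) j σ]
  congr 1
  ext s; simp

lemma CommutesTens.sub_sum {α : Type*} [Fintype α] [DecidableEq α] {N : ℕ}
    {T : (α → Fin N) → (α → Fin N) → ℂ} (hT : CommutesTens T) (c : Equiv.Perm α → ℂ) :
    CommutesTens fun i j => T i j - ∑ σ, c σ * if i = j ∘ σ then (1 : ℂ) else 0 := by
  intro V hV i j
  simp only [mul_sub, sub_mul, Finset.sum_sub_distrib, hT V hV i j, Finset.mul_sum,
    Finset.sum_mul]
  congr 1
  rw [Finset.sum_comm]
  conv_rhs => rw [Finset.sum_comm]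
  refine Finset.sum_congr rfl fun σ _ => ?_
  have := commutesTens_perm σ V hV i j
  simp only [mul_left_comm _ (c σ), mul_assoc, ← Finset.mul_sum]
  rw [this]

lemma CommutesTens.exists_perm {α : Type*} [Fintype α] [DecidableEq α] {N : ℕ}
    {T : (α → Fin N) → (α → Fin N) → ℂ} (hT : CommutesTens T) (i j : α → Fin N)
    (h : T i j ≠ 0) : ∃ σ : Equiv.Perm α, i = j ∘ σ := by
  have hcard : ∀ k, Fintype.card {s // i s = k} = Fintype.card {s // j s = k} := by
    intro k
    have hp := Complex.isPrimitiveRoot_exp (Fintype.card α + 1) (by omega)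
    set w := Complex.exp (2 * Real.pi * Complex.I / (Fintype.card α + 1 : ℕ)) with hw
    have hw1 : ‖w‖ = 1 := hp.norm'_eq_one (by omega)
    set t : Fin N → ℂ := fun x => if x = k then w else 1 with ht
    have htn : ∀ x, star (t x) * t x = 1 := by
      intro x
      have : ‖t x‖ = 1 := by simp only [ht]; split_ifs <;> simp [hw1]
      rw [Complex.star_def, ← Complex.normSq_eq_conj_mul_self, Complex.normSq_eq_norm_sq, this]
      simp
    have hV : Matrix.diagonal t ∈ Matrix.unitaryGroup (Fin N) ℂ := by
      rw [Matrix.mem_unitaryGroup_iff', Matrix.star_eq_conjTranspose,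
        Matrix.diagonal_conjTranspose, Matrix.diagonal_mul_diagonal, ← Matrix.diagonal_one]
      congr 1
      ext x
      exact htn x
    have hd : ∀ i l : α → Fin N, tens (Matrix.diagonal t) i l =
        if i = l then w ^ Fintype.card {s // i s = k} else 0 := by
      intro i l
      split_ifs with hil
      · subst hil
        simp only [tens, Matrix.diagonal_apply_eq, ht, Finset.prod_ite, Finset.prod_const_one,
          mul_one, Finset.prod_const, Fintype.card_subtype]
      · obtain ⟨s, hs⟩ := Function.ne_iff.mp hil
        exact Finset.prod_eq_zero (Finset.mem_univ s) (Matrix.diagonal_apply_ne _ hs)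
    have h2 := hT _ hV i j
    simp only [hd, ite_mul, zero_mul, mul_ite, mul_zero, Finset.sum_ite_eq, Finset.sum_ite_eq',
      Finset.mem_univ, if_true] at h2
    rw [mul_comm] at h2
    exact hp.pow_inj (Nat.lt_succ_of_le (Fintype.card_subtype_le _))
      (Nat.lt_succ_of_le (Fintype.card_subtype_le _)) (mul_left_cancel₀ h h2)
  refine ⟨Equiv.ofFiberEquiv (f := i) (g := j) fun k => Fintype.equivOfCardEq (hcard k), ?_⟩
  funext s
  exact (Equiv.ofFiberEquiv_map _ s).symm

lemma CommutesTens.eq_zero_of_injective {α : Type*} [Fintype α] [DecidableEq α] {N : ℕ}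
    {T : (α → Fin N) → (α → Fin N) → ℂ} (hT : CommutesTens T) (v v' : α → Fin N)
    (hv : Function.Injective v) (hv' : Function.Injective v') (h : ∀ i, T i v = 0)
    (i : α → Fin N) : T i v' = 0 := by
  let e : {x // x ∈ Set.range v} ≃ {x // x ∈ Set.range v'} :=
    (Equiv.ofInjective v hv).symm.trans (Equiv.ofInjective v' hv')
  let p : Equiv.Perm (Fin N) := e.extendSubtype
  have hp : ∀ s, p (v s) = v' s := by
    intro s
    have := e.extendSubtype_apply_of_mem (v s) ⟨s, rfl⟩
    rw [show p (v s) = _ from this]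
    have h2 : (⟨v s, ⟨s, rfl⟩⟩ : Set.range v) = Equiv.ofInjective v hv s := rfl
    change ((Equiv.ofInjective v' hv') ((Equiv.ofInjective v hv).symm ⟨v s, _⟩) : Fin N) = v' s
    rw [h2, Equiv.symm_apply_apply]; rfl
  set V : Matrix (Fin N) (Fin N) ℂ := Matrix.of fun a b => if a = p b then 1 else 0 with hVd
  have hV : V ∈ Matrix.unitaryGroup (Fin N) ℂ := by
    rw [Matrix.mem_unitaryGroup_iff']
    ext a b
    simp [Matrix.mul_apply, hVd, Matrix.star_apply, Matrix.one_apply, eq_comm]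
  have hl : ∀ l : α → Fin N, tens V l v = if l = v' then 1 else 0 := by
    intro l
    split_ifs with hlv
    · exact Finset.prod_eq_one fun s _ => by simp [hVd, hlv, hp]
    · obtain ⟨s, hs⟩ := Function.ne_iff.mp hlv
      exact Finset.prod_eq_zero (Finset.mem_univ s) (by simp [hVd, hp, hs])
  have := hT V hV i v
  simpa [h, hl] using this.symm

/-- The Householder reflection along `e_c + 2 e_k`. -/
noncomputable def reflMat {N : ℕ} (c k : Fin N) : Matrix (Fin N) (Fin N) ℂ :=
  1 - (2 / 5 : ℂ) • Matrix.vecMulVec (Pi.single c 1 + Pi.single k 2)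
    (Pi.single c 1 + Pi.single k 2)

lemma reflMat_mem {N : ℕ} (c k : Fin N) (h : c ≠ k) :
    reflMat c k ∈ Matrix.unitaryGroup (Fin N) ℂ := by
  have hs : star (reflMat c k) = reflMat c k := by
    rw [Matrix.star_eq_conjTranspose]
    ext a b
    simp only [reflMat, Matrix.conjTranspose_apply, Matrix.sub_apply, Matrix.smul_apply,
      Matrix.vecMulVec_apply, Matrix.one_apply, Pi.add_apply, Pi.single_apply, smul_eq_mul]
    have h1 : ∀ P : Prop, ∀ _ : Decidable P, star (if P then (2 : ℂ) else 0) = if P then 2 else 0 := by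
      intro P _; split_ifs <;> simp
    have h2 : ∀ P : Prop, ∀ _ : Decidable P, star (if P then (1 : ℂ) else 0) = if P then 1 else 0 := by
      intro P _; split_ifs <;> simp
    have h3 : star (2 / 5 : ℂ) = 2 / 5 := by simp
    simp only [star_sub, star_mul', star_add, h1, h2, h3]
    simp only [eq_comm (a := a) (b := b)]
    ring
  rw [Matrix.mem_unitaryGroup_iff, hs, reflMat, sub_mul, mul_sub, mul_sub, Matrix.one_mul,
    Matrix.one_mul, Matrix.mul_one, Matrix.smul_mul, Matrix.mul_smul, Matrix.vecMulVec_mul_vecMulVec]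
  have : (Pi.single c 1 + Pi.single k 2 : Fin N → ℂ) ⬝ᵥ (Pi.single c 1 + Pi.single k 2) = 5 := by
    simp [h, h.symm]; norm_num
  rw [this]
  ext a b
  simp only [Matrix.sub_apply, Matrix.smul_apply, Matrix.vecMulVec_apply, Pi.smul_apply,
    smul_eq_mul]
  ring

lemma CommutesTens.eq_zero {α : Type*} [Fintype α] [DecidableEq α] {N : ℕ}
    (hN : Fintype.card α ≤ N)
    {T : (α → Fin N) → (α → Fin N) → ℂ} (hT : CommutesTens T)
    (h : ∀ v, Function.Injective v → ∀ i, T i v = 0) (n : ℕ) (i j : α → Fin N)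
    (hn : Fintype.card α ≤ n + (Finset.univ.image j).card) : T i j = 0 := by
  induction n generalizing i j with
  | zero =>
    refine h j ?_ i
    rw [← Set.injOn_univ, ← Finset.coe_univ, ← Finset.card_image_iff]
    refine le_antisymm Finset.card_image_le ?_
    rw [Finset.card_univ]; omega
  | succ n ih =>
    by_cases hinj : Function.Injective j
    · exact h j hinj i
    by_contra hne
    obtain ⟨a, b, hab, hne'⟩ : ∃ a b, j a = j b ∧ a ≠ b := by
      simpa [Function.Injective] using hinj
    have hlt : (Finset.univ.image j).card < Fintype.card α := by
      refine lt_of_le_of_ne (by simpa using Finset.card_image_le (s := Finset.univ) (f := j)) ?_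
      intro h'
      rw [← Finset.card_univ, Finset.card_image_iff, Finset.coe_univ, Set.injOn_univ] at h'
      exact hinj h'
    obtain ⟨k, hk⟩ : ∃ k, k ∉ Finset.univ.image j := by
      by_contra hall
      push Not at hall
      have : (Finset.univ : Finset (Fin N)).card ≤ (Finset.univ.image j).card :=
        Finset.card_le_card fun x _ => hall x
      rw [Finset.card_univ, Fintype.card_fin] at this
      omega
    have hjk : ∀ s, j s ≠ k := fun s hs => hk (Finset.mem_image.mpr ⟨s, Finset.mem_univ s, hs⟩)
    set c := j a with hc
    set j' := Function.update j a k with hj'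
    have himg : (Finset.univ.image j').card = (Finset.univ.image j).card + 1 := by
      rw [← Finset.card_insert_of_notMem hk]
      congr 1
      ext x
      simp only [Finset.mem_image, Finset.mem_univ, true_and, Finset.mem_insert]
      constructor
      · rintro ⟨s, rfl⟩
        by_cases hs : s = a
        · left; simp [hj', hs]
        · right; exact ⟨s, by simp [hj', hs]⟩
      · rintro (rfl | ⟨s, rfl⟩)
        · exact ⟨a, by simp [hj']⟩
        · by_cases hs : s = a
          · exact ⟨b, by rw [hj', Function.update_of_ne hne'.symm, ← hab, hs]⟩
          · exact ⟨s, by simp [hj', hs]⟩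
    have hz : ∀ l, T l j' = 0 := fun l => ih l j' (by omega)
    have hck : c ≠ k := hjk a
    have h2 := hT _ (reflMat_mem c k hck) i j'
    rw [Finset.sum_eq_zero (fun l _ => by rw [hz, mul_zero]), Finset.sum_eq_single j] at h2
    · rcases mul_eq_zero.mp h2.symm with h3 | h3
      · exact hne h3
      · rw [tens, Finset.prod_eq_zero_iff] at h3
        obtain ⟨s, -, hs⟩ := h3
        by_cases hsa : s = a
        · subst hsa
          simp [hj', reflMat, Matrix.vecMulVec_apply, ← hc, hck, hck.symm] at hs
        · rw [hj', Function.update_of_ne hsa] at hs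
          by_cases hsc : j s = c
          · simp [reflMat, Matrix.vecMulVec_apply, hsc, hck] at hs
            norm_num at hs
          · simp [reflMat, Matrix.vecMulVec_apply, hsc, hjk s] at hs
    · intro l _ hlj
      by_contra hl
      obtain ⟨hl1, hl2⟩ := mul_ne_zero_iff.mp hl
      obtain ⟨σ, hσ⟩ := hT.exists_perm i l hl1
      obtain ⟨τ, hτ⟩ := hT.exists_perm i j hne
      have hlk : ∀ s, l s ≠ k := by
        intro s
        have h4 : l s = j (τ (σ.symm s)) := by
          have := congrFun (hσ.symm.trans hτ) (σ.symm s)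
          simpa using this
        rw [h4]; exact hjk _
      apply hlj
      ext1 s
      have hs : reflMat c k (l s) (j' s) ≠ 0 := (Finset.prod_ne_zero_iff.mp hl2) s (Finset.mem_univ s)
      by_contra hls
      apply hs
      by_cases hsa : s = a
      · subst hsa
        rw [← hc] at hls
        simp [hj', reflMat, Matrix.vecMulVec_apply, hls, hlk s]
      · rw [hj', Function.update_of_ne hsa]
        by_cases hsc : j s = c
        · rw [hsc] at hls
          simp [reflMat, Matrix.vecMulVec_apply, hsc, hls, hlk s]
        · simp [reflMat, Matrix.vecMulVec_apply, hls, hlk s, hsc, hjk s]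
    · simp

lemma CommutesTens.exists_eq_sum {α : Type*} [Fintype α] [DecidableEq α] {N : ℕ}
    (hN : Fintype.card α ≤ N)
    {T : (α → Fin N) → (α → Fin N) → ℂ} (hT : CommutesTens T) :
    ∃ c : Equiv.Perm α → ℂ, ∀ i j, T i j = ∑ σ, c σ * if i = j ∘ σ then (1 : ℂ) else 0 := by
  obtain ⟨v⟩ : Nonempty (α ↪ Fin N) :=
    Function.Embedding.nonempty_of_card_le (by simpa using hN)
  let c : Equiv.Perm α → ℂ := fun σ => T (v ∘ σ) v
  have hS := hT.sub_sum c
  refine ⟨c, fun i j => sub_eq_zero.mp (hS.eq_zero hN (fun v' hv' i' =>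
    hS.eq_zero_of_injective v v' v.injective hv' (fun i => ?_) i') (Fintype.card α) i j (by omega))⟩
  rw [sub_eq_zero]
  by_cases hi : ∃ σ : Equiv.Perm α, i = v ∘ σ
  · obtain ⟨σ, rfl⟩ := hi
    rw [Finset.sum_eq_single σ]
    · simp [c]
    · intro τ _ hτ
      rw [if_neg, mul_zero]
      intro h
      apply hτ
      ext s
      exact v.injective (congrFun h s).symm
    · simp
  · push Not at hi
    have h0 : T i v = 0 := by
      by_contra h
      obtain ⟨σ, hσ⟩ := hT.exists_perm i v h
      exact hi σ hσ
    rw [h0, Finset.sum_eq_zero]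
    intro σ _
    rw [if_neg (hi σ), mul_zero]

/-- The conjugate `U B U⁻¹` of a matrix by a unitary matrix. -/
noncomputable def conjMat {N : ℕ} (B : Matrix (Fin N) (Fin N) ℂ)
    (U : Matrix.unitaryGroup (Fin N) ℂ) : Matrix (Fin N) (Fin N) ℂ :=
  (U : Matrix (Fin N) (Fin N) ℂ) * B *
    ((U⁻¹ : Matrix.unitaryGroup (Fin N) ℂ) : Matrix (Fin N) (Fin N) ℂ)

lemma conjMat_mul {N : ℕ} (B : Matrix (Fin N) (Fin N) ℂ)
    (V U : Matrix.unitaryGroup (Fin N) ℂ) :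
    conjMat B (V * U) * (V : Matrix (Fin N) (Fin N) ℂ) =
      (V : Matrix (Fin N) (Fin N) ℂ) * conjMat B U := by
  have h : ((V⁻¹ : Matrix.unitaryGroup (Fin N) ℂ) : Matrix (Fin N) (Fin N) ℂ) *
      (V : Matrix (Fin N) (Fin N) ℂ) = 1 := by
    rw [← Submonoid.coe_mul, inv_mul_cancel, Submonoid.coe_one]
  simp only [conjMat, _root_.mul_inv_rev, Submonoid.coe_mul, mul_assoc, h, mul_one]

lemma continuous_conjMat {N : ℕ} (B : Matrix (Fin N) (Fin N) ℂ) : Continuous (conjMat B) := by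
  have h : Continuous fun U : Matrix.unitaryGroup (Fin N) ℂ =>
      ((U⁻¹ : Matrix.unitaryGroup (Fin N) ℂ) : Matrix (Fin N) (Fin N) ℂ) := by
    change Continuous fun U : Matrix.unitaryGroup (Fin N) ℂ =>
      star (U : Matrix (Fin N) (Fin N) ℂ)
    exact continuous_subtype_val.star
  exact (continuous_subtype_val.mul continuous_const).mul h

lemma norm_conjMat_le {N : ℕ} (B : Matrix (Fin N) (Fin N) ℂ) :
    ∃ C : ℝ, 0 ≤ C ∧ ∀ U i j, ‖conjMat B U i j‖ ≤ C := by
  refine ⟨∑ a, ∑ b, ‖B a b‖, by positivity, fun U i j => ?_⟩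
  have h : ∀ (V : Matrix.unitaryGroup (Fin N) ℂ) a b, ‖(V : Matrix (Fin N) (Fin N) ℂ) a b‖ ≤ 1 :=
    fun V a b => entry_norm_bound_of_unitary V.2 a b
  rw [conjMat, Matrix.mul_apply, Finset.sum_comm]
  refine (norm_sum_le _ _).trans (Finset.sum_le_sum fun b _ => ?_)
  rw [norm_mul, Matrix.mul_apply]
  refine (mul_le_of_le_one_right (norm_nonneg _) (h _ _ _)).trans ?_
  refine (norm_sum_le _ _).trans (Finset.sum_le_sum fun a _ => ?_)
  rw [norm_mul]
  exact mul_le_of_le_one_left (norm_nonneg _) (h _ _ _)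

lemma integrable_of_continuous_of_bound {N : ℕ} (μ : Measure (Matrix.unitaryGroup (Fin N) ℂ))
    [IsProbabilityMeasure μ] (f : Matrix.unitaryGroup (Fin N) ℂ → ℂ) (hf : Continuous f)
    (C : ℝ) (h : ∀ U, ‖f U‖ ≤ C) : Integrable f μ :=
  Integrable.of_bound hf.aestronglyMeasurable C (Filter.Eventually.of_forall h)

lemma integrable_tens_conjMat {α : Type*} [Fintype α] {N : ℕ}
    (μ : Measure (Matrix.unitaryGroup (Fin N) ℂ)) [IsProbabilityMeasure μ]
    (B : Matrix (Fin N) (Fin N) ℂ) (i j : α → Fin N) :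
    Integrable (fun U => tens (conjMat B U) i j) μ := by
  obtain ⟨C, hC0, hC⟩ := norm_conjMat_le B
  refine integrable_of_continuous_of_bound μ _ ?_ (C ^ Fintype.card α) fun U => ?_
  · exact continuous_finsetProd _ fun s _ => (continuous_conjMat B).matrix_elem _ _
  · rw [tens, norm_prod, ← Finset.card_univ, ← Finset.prod_const]
    exact Finset.prod_le_prod (fun _ _ => norm_nonneg _) fun s _ => hC _ _ _

/-- The Haar average of the tensor power of `U B U⁻¹`. -/
noncomputable def avgTens {α : Type*} [Fintype α] {N : ℕ}
    (μ : Measure (Matrix.unitaryGroup (Fin N) ℂ)) (B : Matrix (Fin N) (Fin N) ℂ)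
    (i j : α → Fin N) : ℂ := ∫ U, tens (conjMat B U) i j ∂μ

lemma commutesTens_avgTens {α : Type*} [Fintype α] [DecidableEq α] {N : ℕ}
    (μ : Measure (Matrix.unitaryGroup (Fin N) ℂ)) [IsProbabilityMeasure μ] [μ.IsMulLeftInvariant]
    (B : Matrix (Fin N) (Fin N) ℂ) : CommutesTens (avgTens (α := α) μ B) := by
  intro V hV i j
  have h1 : ∑ l, tens V i l * avgTens μ B l j =
      ∫ U, tens (V * conjMat B U) i j ∂μ := by
    simp only [avgTens, tens_mul, ← integral_const_mul]
    rw [integral_finsetSum]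
    exact fun l _ => (integrable_tens_conjMat μ B l j).const_mul _
  have h2 : ∑ l, avgTens μ B i l * tens V l j =
      ∫ U, tens (conjMat B U * V) i j ∂μ := by
    simp only [avgTens, tens_mul, ← integral_mul_const]
    rw [integral_finsetSum]
    exact fun l _ => (integrable_tens_conjMat μ B i l).mul_const _
  rw [h1, h2, ← integral_mul_left_eq_self (fun U => tens (conjMat B U * V) i j)
    (⟨V, hV⟩ : Matrix.unitaryGroup (Fin N) ℂ)]
  refine integral_congr_ae (Filter.Eventually.of_forall fun U => ?_)
  exact congrArg (fun W => tens W i j) (conjMat_mul B ⟨V, hV⟩ U).symm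

lemma integral_trace_pow {α : Type*} [Fintype α] [DecidableEq α] {N : ℕ}
    (μ : Measure (Matrix.unitaryGroup (Fin N) ℂ)) [IsProbabilityMeasure μ]
    (A B : Matrix (Fin N) (Fin N) ℂ) :
    ∫ U, (A * conjMat B U).trace ^ Fintype.card α ∂μ =
      ∑ i : α → Fin N, ∑ l, tens A i l * avgTens μ B l i := by
  have h : ∀ U, (A * conjMat B U).trace ^ Fintype.card α =
      ∑ i : α → Fin N, ∑ l, tens A i l * tens (conjMat B U) l i := by
    intro U
    simp only [← tens_mul]
    rw [Matrix.trace, ← Finset.card_univ, ← Finset.prod_const, Finset.prod_univ_sum,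
      Fintype.piFinset_univ]
    rfl
  simp only [h, avgTens, ← integral_const_mul]
  rw [integral_finsetSum]
  · refine Finset.sum_congr rfl fun i _ => ?_
    rw [integral_finsetSum]
    exact fun l _ => (integrable_tens_conjMat μ B l i).const_mul _
  · exact fun i _ => integrable_finsetSum _ fun l _ =>
      (integrable_tens_conjMat μ B l i).const_mul _

lemma sum_avgTens_comp {α : Type*} [Fintype α] [DecidableEq α] {N : ℕ}
    (μ : Measure (Matrix.unitaryGroup (Fin N) ℂ)) [IsProbabilityMeasure μ]
    (B : Matrix (Fin N) (Fin N) ℂ) (π : Equiv.Perm α) :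
    ∑ i, avgTens μ B i (i ∘ π) = permTr B π := by
  simp only [avgTens]
  rw [← integral_finsetSum _ fun i _ => integrable_tens_conjMat μ B i _]
  have h : ∀ U, ∑ i : α → Fin N, tens (conjMat B U) i (i ∘ π) = permTr B π := by
    intro U
    rw [← permTr_eq_tens, conjMat, mul_assoc, permTr_matrix_mul_comm, mul_assoc,
      ← Submonoid.coe_mul, inv_mul_cancel, Submonoid.coe_one, mul_one]
  simp [h]

/-- The twisted partition function: the sum over all `(σ, L)` of weighted products of
trace invariants. -/
noncomputable def fullSum {α : Type*} [Fintype α] [DecidableEq α] {N : ℕ}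
    (A B : Matrix (Fin N) (Fin N) ℂ) (key : α → ℕ) (e : List α) : ℂ :=
  ∑ σ : Equiv.Perm α, ∑' L : α → List α,
    famWt (keyWt key (-(N : ℂ)⁻¹)) L * (permTr A (σ * famProd e L)⁻¹ * permTr B σ)

lemma pow_mul_integral_trace_pow {α : Type*} [Fintype α] [DecidableEq α] {N : ℕ} (hN0 : 0 < N)
    (μ : Measure (Matrix.unitaryGroup (Fin N) ℂ)) [IsProbabilityMeasure μ] [μ.IsMulLeftInvariant]
    (A B : Matrix (Fin N) (Fin N) ℂ) (key : α → ℕ) (hN : Fintype.card α ≤ N) (e : List α)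
    (he : e.Pairwise fun a b => key a < key b) (hc : ∀ a, a ∈ e) :
    (N : ℂ) ^ Fintype.card α * ∫ U, (A * conjMat B U).trace ^ Fintype.card α ∂μ =
      fullSum A B key e := by
  obtain ⟨c, hcoef⟩ := (commutesTens_avgTens (α := α) μ B).exists_eq_sum hN
  have hJ : ∫ U, (A * conjMat B U).trace ^ Fintype.card α ∂μ = ∑ σ, c σ * permTr A σ := by
    rw [integral_trace_pow (α := α)]
    simp only [hcoef, permTr_eq_tens, Finset.mul_sum]
    conv_rhs => rw [Finset.sum_comm]
    refine Finset.sum_congr rfl fun i _ => ?_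
    rw [Finset.sum_comm]
    refine Finset.sum_congr rfl fun σ _ => ?_
    rw [Finset.sum_eq_single (i ∘ σ)]
    · rw [if_pos rfl]; ring
    · intro l _ hl
      rw [if_neg hl, mul_zero, mul_zero]
    · simp
  have hB : ∀ π : Equiv.Perm α, ∑ σ, c σ * permTr (1 : Matrix (Fin N) (Fin N) ℂ) (π * σ) =
      permTr B π := by
    intro π
    rw [← sum_avgTens_comp μ B π]
    simp only [hcoef, permTr_eq_tens, Finset.mul_sum]
    rw [Finset.sum_comm]
    refine Finset.sum_congr rfl fun i _ => Finset.sum_congr rfl fun σ _ => ?_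
    congr 1
    rw [tens]
    split_ifs with h
    · refine Finset.prod_eq_one fun s _ => ?_
      rw [Matrix.one_apply, if_pos]
      exact congrFun h s
    · obtain ⟨s, hs⟩ := Function.ne_iff.mp h
      exact Finset.prod_eq_zero (Finset.mem_univ s) (Matrix.one_apply_ne hs)
  have hg := fun g => sum_permTr_one_mul hN0 key hN e he hc (fun g => permTr A g⁻¹) g
  rw [hJ, Finset.mul_sum]
  have h3 : ∀ σ : Equiv.Perm α, (N : ℂ) ^ Fintype.card α * (c σ * permTr A σ) =
      ∑ π : Equiv.Perm α, c σ * permTr (1 : Matrix (Fin N) (Fin N) ℂ) (π * σ) *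
        ∑' L : α → List α, famWt (keyWt key (-(N : ℂ)⁻¹)) L * permTr A (π * famProd e L)⁻¹ := by
    intro σ
    have := hg σ⁻¹
    rw [inv_inv] at this
    rw [mul_left_comm, ← this, Finset.mul_sum,
      ← Equiv.sum_comp (Equiv.mulLeft σ)]
    refine Finset.sum_congr rfl fun π _ => ?_
    rw [Equiv.coe_mulLeft, inv_mul_cancel_left, permTr_mul_comm, mul_assoc]
  simp only [h3]
  rw [Finset.sum_comm, fullSum]
  refine Finset.sum_congr rfl fun π _ => ?_
  rw [← Finset.sum_mul, hB, ← tsum_mul_left]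
  refine tsum_congr fun L => ?_
  ring

/-- Pairs of a permutation and a family of words. -/
abbrev PermFam (α : Type*) := Equiv.Perm α × (α → List α)

/-- The equivalence relation generated by the permutation and the transpositions of the words. -/
def Reach {α : Type*} (d : PermFam α) : α → α → Prop :=
  Relation.EqvGen fun x y => y = d.1 x ∨ x ∈ d.2 y

/-- The permutation and the words act transitively. -/
def Conn {α : Type*} (d : PermFam α) : Prop := ∀ x y, Reach d x y

/-- Glue families of words on a subtype and its complement. -/
def glueFam {α : Type*} (p : α → Prop) [DecidablePred p]
    (L₁ : {a // p a} → List {a // p a}) (L₂ : {a // ¬p a} → List {a // ¬p a}) (b : α) : List α :=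
  if h : p b then (L₁ ⟨b, h⟩).map Subtype.val else (L₂ ⟨b, h⟩).map Subtype.val

/-- Glue data on a subtype and its complement. -/
def glue {α : Type*} (p : α → Prop) [DecidablePred p]
    (d : PermFam {a // p a} × PermFam {a // ¬p a}) : PermFam α :=
  (Equiv.Perm.subtypeCongr d.1.1 d.2.1, glueFam p d.1.2 d.2.2)

lemma glueFam_pos {α : Type*} (p : α → Prop) [DecidablePred p]
    (L₁ : {a // p a} → List {a // p a}) (L₂ : {a // ¬p a} → List {a // ¬p a}) (b : {a // p a}) :
    glueFam p L₁ L₂ b = (L₁ b).map Subtype.val := dif_pos b.2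

lemma glueFam_neg {α : Type*} (p : α → Prop) [DecidablePred p]
    (L₁ : {a // p a} → List {a // p a}) (L₂ : {a // ¬p a} → List {a // ¬p a}) (b : {a // ¬p a}) :
    glueFam p L₁ L₂ b = (L₂ b).map Subtype.val := dif_neg b.2

lemma glue_injective {α : Type*} (p : α → Prop) [DecidablePred p] :
    Function.Injective (glue (α := α) p) := by
  rintro ⟨⟨σ₁, L₁⟩, σ₂, L₂⟩ ⟨⟨σ₁', L₁'⟩, σ₂', L₂'⟩ h
  simp only [glue, Prod.mk.injEq] at h
  obtain ⟨h1, h2⟩ := h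
  have h3 := Equiv.Perm.subtypeCongrHom_injective p (a₁ := (σ₁, σ₂)) (a₂ := (σ₁', σ₂')) h1
  rw [Prod.mk.injEq] at h3
  have h4 : L₁ = L₁' := by
    funext b
    have := congrFun h2 b
    rw [glueFam_pos, glueFam_pos] at this
    exact (List.map_injective_iff.mpr Subtype.val_injective) this
  have h5 : L₂ = L₂' := by
    funext b
    have := congrFun h2 b
    rw [glueFam_neg, glueFam_neg] at this
    exact (List.map_injective_iff.mpr Subtype.val_injective) this
  simp [h3, h4, h5]

lemma reach_glue {α : Type*} (p : α → Prop) [DecidablePred p]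
    (d : PermFam {a // p a} × PermFam {a // ¬p a}) (x : {a // p a}) (y : α) :
    Reach (glue p d) x y ↔ ∃ hy : p y, Reach d.1 x ⟨y, hy⟩ := by
  constructor
  · intro h
    have key : ∀ x y, Reach (glue p d) x y → (p x ↔ p y) ∧
        ∀ (hx : p x) (hy : p y), Reach d.1 ⟨x, hx⟩ ⟨y, hy⟩ := by
      intro x y h
      induction h with
      | rel x y h =>
        rcases h with h | h
        · by_cases hx : p x
          · have h1 : y = d.1.1 ⟨x, hx⟩ := by
              rw [h]; exact Equiv.Perm.subtypeCongr.left_apply _ _ hx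
            have hy : p y := h1 ▸ (d.1.1 ⟨x, hx⟩).2
            refine ⟨iff_of_true hx hy, fun _ _ => Relation.EqvGen.rel _ _ (Or.inl ?_)⟩
            exact Subtype.ext h1
          · have h1 : y = d.2.1 ⟨x, hx⟩ := by
              rw [h]; exact Equiv.Perm.subtypeCongr.right_apply _ _ hx
            have hy : ¬p y := h1 ▸ (d.2.1 ⟨x, hx⟩).2
            exact ⟨iff_of_false hx hy, fun hx' _ => absurd hx' hx⟩
        · change x ∈ glueFam p d.1.2 d.2.2 y at h
          by_cases hy : p y
          · rw [glueFam, dif_pos hy] at h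
            obtain ⟨x', hx', rfl⟩ := List.mem_map.mp h
            exact ⟨iff_of_true x'.2 hy, fun _ _ => Relation.EqvGen.rel _ _ (Or.inr hx')⟩
          · rw [glueFam, dif_neg hy] at h
            obtain ⟨x', hx', rfl⟩ := List.mem_map.mp h
            exact ⟨iff_of_false x'.2 hy, fun hx _ => absurd hx x'.2⟩
      | refl x => exact ⟨Iff.rfl, fun _ _ => Relation.EqvGen.refl _⟩
      | symm x y _ ih => exact ⟨ih.1.symm, fun hx hy => (ih.2 hy hx).symm⟩
      | trans x y z _ _ ih1 ih2 =>
        exact ⟨ih1.1.trans ih2.1, fun hx hz =>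
          (ih1.2 hx (ih1.1.mp hx)).trans _ _ _ (ih2.2 (ih1.1.mp hx) hz)⟩
    have := key x y h
    exact ⟨this.1.mp x.2, this.2 x.2 (this.1.mp x.2)⟩
  · rintro ⟨hy, h⟩
    have key : ∀ x y : {a // p a}, Reach d.1 x y → Reach (glue p d) x y := by
      intro x y h
      induction h with
      | rel x y h =>
        refine Relation.EqvGen.rel _ _ ?_
        rcases h with h | h
        · left
          rw [h]; exact (Equiv.Perm.subtypeCongr.left_apply _ _ x.2).symm
        · right
          change (x : α) ∈ glueFam p d.1.2 d.2.2 y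
          rw [glueFam_pos]
          exact List.mem_map_of_mem h
      | refl x => exact Relation.EqvGen.refl _
      | symm x y _ ih => exact ih.symm
      | trans x y z _ _ ih1 ih2 => exact ih1.trans _ _ _ ih2
    exact key _ _ h

lemma exists_glue {α : Type*} (p : α → Prop) [DecidablePred p] (d : PermFam α) (s₀ : α)
    (h : ∀ y, Reach d s₀ y ↔ p y) : ∃ d', glue p d' = d := by
  obtain ⟨σ, L⟩ := d
  have h1 : ∀ x, p (σ x) ↔ p x := by
    intro x
    have hr : Reach (σ, L) x (σ x) := Relation.EqvGen.rel _ _ (Or.inl rfl)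
    rw [← h, ← h]
    exact ⟨fun h' => h'.trans _ _ _ hr.symm, fun h' => h'.trans _ _ _ hr⟩
  have h2 : ∀ x y, x ∈ L y → (p x ↔ p y) := by
    intro x y hxy
    have hr : Reach (σ, L) x y := Relation.EqvGen.rel _ _ (Or.inr hxy)
    rw [← h, ← h]
    exact ⟨fun h' => h'.trans _ _ _ hr, fun h' => h'.trans _ _ _ hr.symm⟩
  refine ⟨((σ.subtypePerm h1, fun b => (L b).attachWith p fun x hx => (h2 x b hx).mpr b.2),
    (σ.subtypePerm fun x => not_congr (h1 x), fun b => (L b).attachWith (fun a => ¬p a)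
      fun x hx => (not_congr (h2 x b hx)).mpr b.2)), ?_⟩
  refine Prod.ext ?_ ?_
  · ext x
    by_cases hx : p x
    · exact Equiv.Perm.subtypeCongr.left_apply _ _ hx
    · exact Equiv.Perm.subtypeCongr.right_apply _ _ hx
  · funext b
    change glueFam p _ _ b = L b
    by_cases hb : p b
    · rw [glueFam, dif_pos hb]
      exact List.attachWith_map_subtype_val _
    · rw [glueFam, dif_neg hb]
      exact List.attachWith_map_subtype_val _

lemma permTr_subtypeCongr {α : Type*} [Fintype α] [DecidableEq α] (p : α → Prop)
    [DecidablePred p] {N : ℕ} (A : Matrix (Fin N) (Fin N) ℂ) (ρ₁ : Equiv.Perm {a // p a})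
    (ρ₂ : Equiv.Perm {a // ¬p a}) :
    permTr A (Equiv.Perm.subtypeCongr ρ₁ ρ₂) = permTr A ρ₁ * permTr A ρ₂ := by
  rw [permTr, permTr, permTr, Finset.sum_mul_sum, ← Finset.sum_product', Finset.univ_product_univ,
    ← Equiv.sum_comp (Equiv.piEquivPiSubtypeProd p fun _ => Fin N)]
  refine Finset.sum_congr rfl fun i _ => ?_
  rw [← Fintype.prod_subtype_mul_prod_subtype p]
  congr 1
  · refine Finset.prod_congr rfl fun s _ => ?_
    rw [Equiv.Perm.subtypeCongr.left_apply _ _ s.2]; rfl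
  · refine Finset.prod_congr rfl fun s _ => ?_
    rw [Equiv.Perm.subtypeCongr.right_apply _ _ s.2]; rfl

lemma famWt_glueFam {α : Type*} [Fintype α] (p : α → Prop)
    [DecidablePred p] (y : α → α → ℂ)
    (L₁ : {a // p a} → List {a // p a}) (L₂ : {a // ¬p a} → List {a // ¬p a}) :
    famWt y (glueFam p L₁ L₂) =
      famWt (fun a b : {a // p a} => y a b) L₁ * famWt (fun a b : {a // ¬p a} => y a b) L₂ := by
  rw [famWt, ← Fintype.prod_subtype_mul_prod_subtype p]
  congr 1
  · refine Finset.prod_congr rfl fun s _ => ?_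
    rw [glueFam_pos, listWt, listWt, List.map_map]; rfl
  · refine Finset.prod_congr rfl fun s _ => ?_
    rw [glueFam_neg, listWt, listWt, List.map_map]; rfl

/-- The sublist of elements satisfying `p`, as a list in the subtype. -/
def subList {α : Type*} (p : α → Prop) [DecidablePred p] (e : List α) : List {a // p a} :=
  e.filterMap fun a => if h : p a then some ⟨a, h⟩ else none

lemma mem_subList {α : Type*} (p : α → Prop) [DecidablePred p] (e : List α) (a : {a // p a})
    (h : (a : α) ∈ e) : a ∈ subList p e := by
  rw [subList, List.mem_filterMap]
  exact ⟨a, h, by simp [a.2]⟩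

lemma pairwise_subList {α : Type*} (p : α → Prop) [DecidablePred p] (e : List α) (key : α → ℕ)
    (h : e.Pairwise fun a b => key a < key b) :
    (subList p e).Pairwise fun a b : {a // p a} => key a < key b := by
  rw [subList, List.pairwise_filterMap]
  refine h.imp fun {a b} hab a' ha' b' hb' => ?_
  split_ifs at ha' hb'
  all_goals simp_all
  rw [← ha', ← hb']; exact hab

lemma swapProd_left {α : Type*} [DecidableEq α] (p : α → Prop) [DecidablePred p]
    (b : {a // p a}) (l : List {a // p a}) :
    swapProd (b : α) (l.map Subtype.val) = Equiv.Perm.subtypeCongrHom p (swapProd b l, 1) := by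
  induction l with
  | nil => exact (map_one (Equiv.Perm.subtypeCongrHom p)).symm
  | cons a l ih =>
    have h1 : Equiv.swap (a : α) b = Equiv.Perm.subtypeCongrHom p (Equiv.swap a b, 1) := by
      ext x
      change _ = Equiv.Perm.subtypeCongr _ _ x
      by_cases hx : p x
      · rw [Equiv.Perm.subtypeCongr.left_apply _ _ hx]
        simp only [Equiv.swap_apply_def, Subtype.ext_iff]
        split_ifs <;> rfl
      · rw [Equiv.Perm.subtypeCongr.right_apply _ _ hx, Equiv.swap_apply_of_ne_of_ne]
        · rfl
        · rintro rfl; exact hx a.2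
        · rintro rfl; exact hx b.2
    have h2 : swapProd (b : α) ((a :: l).map Subtype.val) =
      Equiv.swap (a : α) b * swapProd (b : α) (l.map Subtype.val) := by simp [swapProd]
    have h3 : swapProd b (a :: l) = Equiv.swap a b * swapProd b l := by simp [swapProd]
    rw [h2, h3, ih, h1, ← map_mul]; simp

lemma swapProd_right {α : Type*} [DecidableEq α] (p : α → Prop) [DecidablePred p]
    (b : {a // ¬p a}) (l : List {a // ¬p a}) :
    swapProd (b : α) (l.map Subtype.val) = Equiv.Perm.subtypeCongrHom p (1, swapProd b l) := by
  induction l with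
  | nil => exact (map_one (Equiv.Perm.subtypeCongrHom p)).symm
  | cons a l ih =>
    have h1 : Equiv.swap (a : α) b = Equiv.Perm.subtypeCongrHom p (1, Equiv.swap a b) := by
      ext x
      change _ = Equiv.Perm.subtypeCongr _ _ x
      by_cases hx : p x
      · rw [Equiv.Perm.subtypeCongr.left_apply _ _ hx, Equiv.swap_apply_of_ne_of_ne]
        · rfl
        · rintro rfl; exact a.2 hx
        · rintro rfl; exact b.2 hx
      · rw [Equiv.Perm.subtypeCongr.right_apply _ _ hx]
        simp only [Equiv.swap_apply_def, Subtype.ext_iff]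
        split_ifs <;> rfl
    have h2 : swapProd (b : α) ((a :: l).map Subtype.val) =
      Equiv.swap (a : α) b * swapProd (b : α) (l.map Subtype.val) := by simp [swapProd]
    have h3 : swapProd b (a :: l) = Equiv.swap a b * swapProd b l := by simp [swapProd]
    rw [h2, h3, ih, h1, ← map_mul]; simp

lemma famProd_glueFam {α : Type*} [DecidableEq α] (p : α → Prop) [DecidablePred p]
    (e : List α) (L₁ : {a // p a} → List {a // p a}) (L₂ : {a // ¬p a} → List {a // ¬p a}) :
    famProd e (glueFam p L₁ L₂) = Equiv.Perm.subtypeCongrHom p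
      (famProd (subList p e) L₁, famProd (subList (fun a => ¬p a) e) L₂) := by
  induction e with
  | nil => exact (map_one (Equiv.Perm.subtypeCongrHom p)).symm
  | cons b e ih =>
    have h2 : famProd (b :: e) (glueFam p L₁ L₂) =
      swapProd b (glueFam p L₁ L₂ b) * famProd e (glueFam p L₁ L₂) := by simp [famProd]
    rw [h2, ih]
    by_cases hb : p b
    · have h3 : subList p (b :: e) = ⟨b, hb⟩ :: subList p e := by
        rw [subList, List.filterMap_cons]; simp [hb, subList]
      have h4 : subList (fun a => ¬p a) (b :: e) = subList (fun a => ¬p a) e := by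
        rw [subList, List.filterMap_cons]; simp [hb, subList]
      rw [glueFam, dif_pos hb, h3, h4, swapProd_left p ⟨b, hb⟩, ← map_mul]
      simp [famProd]
    · have h3 : subList p (b :: e) = subList p e := by
        rw [subList, List.filterMap_cons]; simp [hb, subList]
      have h4 : subList (fun a => ¬p a) (b :: e) = ⟨b, hb⟩ :: subList (fun a => ¬p a) e := by
        rw [subList, List.filterMap_cons]; simp [hb, subList]
      rw [glueFam, dif_neg hb, h3, h4, swapProd_right p ⟨b, hb⟩, ← map_mul]
      simp [famProd]

/-- The weighted trace invariant of a permutation and a family of words. -/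
noncomputable def pairWt {α : Type*} [Fintype α] [DecidableEq α] {N : ℕ}
    (A B : Matrix (Fin N) (Fin N) ℂ) (key : α → ℕ) (e : List α) (d : PermFam α) : ℂ :=
  famWt (keyWt key (-(N : ℂ)⁻¹)) d.2 * (permTr A (d.1 * famProd e d.2)⁻¹ * permTr B d.1)

lemma pairWt_glue {α : Type*} [Fintype α] [DecidableEq α] (p : α → Prop) [DecidablePred p] {N : ℕ}
    (A B : Matrix (Fin N) (Fin N) ℂ) (key : α → ℕ) (e : List α)
    (d : PermFam {a // p a} × PermFam {a // ¬p a}) :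
    pairWt A B key e (glue p d) = pairWt A B (fun a : {a // p a} => key a) (subList p e) d.1 *
      pairWt A B (fun a : {a // ¬p a} => key a) (subList (fun a => ¬p a) e) d.2 := by
  have h : ((glue p d).1 * famProd e (glue p d).2)⁻¹ = Equiv.Perm.subtypeCongr
      (d.1.1 * famProd (subList p e) d.1.2)⁻¹
      (d.2.1 * famProd (subList (fun a => ¬p a) e) d.2.2)⁻¹ := by
    change (Equiv.Perm.subtypeCongrHom p (d.1.1, d.2.1) * famProd e (glueFam p d.1.2 d.2.2))⁻¹ =
      Equiv.Perm.subtypeCongrHom p (_, _)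
    rw [famProd_glueFam, ← map_mul, ← map_inv]
    rfl
  rw [pairWt, h, permTr_subtypeCongr]
  change famWt _ (glueFam p d.1.2 d.2.2) *
    (_ * permTr B (Equiv.Perm.subtypeCongr d.1.1 d.2.1)) = _
  rw [famWt_glueFam, permTr_subtypeCongr, pairWt, pairWt]
  unfold keyWt
  ring

lemma summable_norm_pairWt {α : Type*} [Fintype α] [DecidableEq α] {N : ℕ}
    (A B : Matrix (Fin N) (Fin N) ℂ) (key : α → ℕ) (e : List α) (hN : Fintype.card α ≤ N) :
    Summable fun d : PermFam α => ‖pairWt A B key e d‖ := by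
  have hnorm : ∀ b, ∑ a, ‖keyWt key (-(N : ℂ)⁻¹) a b‖ < 1 := by
    refine sum_norm_keyWt_lt key _ ?_
    rw [norm_neg, norm_inv, Complex.norm_natCast, ← div_eq_mul_inv]
    exact div_le_one_of_le₀ (by exact_mod_cast hN) (Nat.cast_nonneg _)
  have h1 := summable_norm_famWt _ hnorm
  obtain ⟨C₁, hC₁, h₁⟩ := exists_norm_bound fun ρ : Equiv.Perm α => permTr A ρ
  obtain ⟨C₂, hC₂, h₂⟩ := exists_norm_bound fun ρ : Equiv.Perm α => permTr B ρ
  have h2 : Summable fun d : PermFam α =>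
      (C₁ * C₂) * ‖famWt (keyWt key (-(N : ℂ)⁻¹)) d.2‖ := by
    refine (summable_prod_of_nonneg fun d => by positivity).mpr ⟨fun σ => ?_, Summable.of_finite⟩
    exact h1.mul_left _
  refine Summable.of_nonneg_of_le (fun d => norm_nonneg _) (fun d => ?_) h2
  rw [pairWt, norm_mul, norm_mul, mul_comm]
  gcongr
  · exact h₁ _
  · exact h₂ _

lemma fullSum_eq_tsum {α : Type*} [Fintype α] [DecidableEq α] {N : ℕ}
    (A B : Matrix (Fin N) (Fin N) ℂ) (key : α → ℕ) (e : List α) (hN : Fintype.card α ≤ N) :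
    fullSum A B key e = ∑' d : PermFam α, pairWt A B key e d := by
  rw [(summable_norm_pairWt A B key e hN).of_norm.tsum_prod, tsum_fintype]
  rfl

open Classical in
/-- The transitive part of `fullSum`. -/
noncomputable def connSum {α : Type*} [Fintype α] [DecidableEq α] {N : ℕ}
    (A B : Matrix (Fin N) (Fin N) ℂ) (key : α → ℕ) (e : List α) : ℂ :=
  ∑' d : PermFam α, if Conn d then pairWt A B key e d else 0

lemma conn_iff {α : Type*} (d : PermFam α) (s₀ : α) : Conn d ↔ ∀ y, Reach d s₀ y :=
  ⟨fun h y => h s₀ y, fun h x y => ((h x).symm).trans _ _ _ (h y)⟩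

lemma fullSum_eq_connSum_add {α : Type*} [Fintype α] [DecidableEq α] {N : ℕ}
    (A B : Matrix (Fin N) (Fin N) ℂ) (key : α → ℕ) (e : List α) (hN : Fintype.card α ≤ N)
    (s₀ : α) :
    fullSum A B key e = connSum A B key e +
      ∑ T ∈ Finset.univ.filter (fun T : Finset α => s₀ ∈ T ∧ T ≠ Finset.univ),
        connSum A B (fun a : {a // a ∈ T} => key a) (subList (· ∈ T) e) *
          fullSum A B (fun a : {a // a ∉ T} => key a) (subList (· ∉ T) e) := by
  classical
  have hs := summable_norm_pairWt A B key e hN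
  have hsT : ∀ (P : PermFam α → Prop) [DecidablePred P], Summable fun d => if P d then pairWt A B key e d else 0 := by
    intro P _
    refine Summable.of_norm_bounded hs fun d => ?_
    split_ifs <;> simp
  let comp : PermFam α → Finset α := fun d => Finset.univ.filter fun y => Reach d s₀ y
  have hmem : ∀ d, s₀ ∈ comp d := fun d =>
    Finset.mem_filter.mpr ⟨Finset.mem_univ _, Relation.EqvGen.refl _⟩
  have h1 : fullSum A B key e = ∑ T : Finset α,
      ∑' d, if comp d = T then pairWt A B key e d else 0 := by
    rw [← Summable.tsum_finsetSum fun T _ => hsT fun d => comp d = T, fullSum_eq_tsum A B key e hN]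
    refine tsum_congr fun d => ?_
    simp
  have h2 : connSum A B key e = ∑' d, if comp d = Finset.univ then pairWt A B key e d else 0 := by
    refine tsum_congr fun d => if_congr ?_ rfl rfl
    rw [conn_iff d s₀, Finset.filter_eq_self]
    simp
  rw [h1, ← Finset.add_sum_erase _ _ (Finset.mem_univ Finset.univ), h2]
  congr 1
  symm
  refine Finset.sum_subset_zero_on_sdiff (fun T hT => ?_) (fun T hT => ?_) (fun T hT => ?_)
  · exact Finset.mem_erase.mpr ⟨(Finset.mem_filter.mp hT).2.2, Finset.mem_univ _⟩
  · have hsT : s₀ ∉ T := by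
      intro h
      simp only [Finset.mem_sdiff, Finset.mem_erase, Finset.mem_filter, Finset.mem_univ,
        and_true, true_and, h, ne_eq, not_not] at hT
      exact hT.1 hT.2
    have hz : ∀ d, (if comp d = T then pairWt A B key e d else 0) = 0 := by
      intro d
      refine if_neg fun h => hsT ?_
      rw [← h]
      exact hmem d
    simp only [hz, tsum_zero]
  · have hs₀ : s₀ ∈ T := (Finset.mem_filter.mp hT).2.1
    have hcard1 : Fintype.card {a // a ∈ T} ≤ N := (Fintype.card_subtype_le _).trans hN
    have hcard2 : Fintype.card {a // a ∉ T} ≤ N := (Fintype.card_subtype_le _).trans hN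
    rw [connSum, fullSum_eq_tsum _ _ _ _ hcard2,
      tsum_mul_tsum_of_summable_norm _ (summable_norm_pairWt _ _ _ _ hcard2)]
    · rw [← (glue_injective (· ∈ T)).tsum_eq]
      · refine tsum_congr fun d => ?_
        rw [pairWt_glue]
        have hiff : comp (glue (· ∈ T) d) = T ↔ Conn d.1 := by
          rw [conn_iff d.1 ⟨s₀, hs₀⟩, Finset.ext_iff]
          simp only [comp, Finset.mem_filter, Finset.mem_univ, true_and]
          have := fun y => reach_glue (· ∈ T) d ⟨s₀, hs₀⟩ y
          simp only at this
          simp only [this]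
          constructor
          · rintro h ⟨y, hy⟩
            exact ((h y).mpr hy).2
          · exact fun h y => ⟨fun h' => h'.1, fun hy => ⟨hy, h ⟨y, hy⟩⟩⟩
        by_cases hc : Conn d.1
        · rw [if_pos hc, if_pos (hiff.mpr hc)]
          congr!
        · rw [if_neg hc, if_neg (mt hiff.mp hc), zero_mul]
      · intro d hd
        have hd' : comp d = T := by
          by_contra h
          exact hd (if_neg h)
        obtain ⟨d', rfl⟩ := exists_glue (· ∈ T) d s₀ (fun y => by rw [← hd']; simp [comp])
        exact ⟨d', rfl⟩
    · refine Summable.of_nonneg_of_le (fun _ => norm_nonneg _) (fun d => ?_)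
        (summable_norm_pairWt A B (fun a : {a // a ∈ T} => key a) (subList (· ∈ T) e) hcard1)
      split_ifs <;> simp

lemma sum_filter_mem_card {α : Type*} [Fintype α] [DecidableEq α] (s₀ : α) (n : ℕ)
    (hn : Fintype.card α = n + 1) (φ : ℕ → ℂ) :
    ∑ T ∈ Finset.univ.filter (fun T : Finset α => s₀ ∈ T), φ T.card =
      ∑ k ∈ Finset.range (n + 1), (n.choose k : ℂ) * φ (k + 1) := by
  have hcard : (Finset.univ.erase s₀).card = n := by
    rw [Finset.card_erase_of_mem (Finset.mem_univ _), Finset.card_univ, hn]; rfl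
  have h := Finset.sum_powerset_apply_card (fun k => φ (k + 1)) (x := Finset.univ.erase s₀)
  rw [hcard] at h
  simp only [nsmul_eq_mul] at h
  rw [← h]
  refine Finset.sum_bij' (fun T _ => T.erase s₀) (fun S _ => insert s₀ S) ?_ ?_ ?_ ?_ ?_
  · intro T _
    exact Finset.mem_powerset.mpr (Finset.erase_subset_erase _ (Finset.subset_univ _))
  · intro S _
    simp
  · intro T hT
    exact Finset.insert_erase (Finset.mem_filter.mp hT).2
  · intro S hS
    refine Finset.erase_insert fun h => ?_
    have := Finset.mem_powerset.mp hS h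
    simp at this
  · intro T hT
    rw [Finset.card_erase_add_one (Finset.mem_filter.mp hT).2]

lemma connSum_eq_of_recurrence {N : ℕ} (A B : Matrix (Fin N) (Fin N) ℂ) (x f : ℕ → ℂ)
    (hx0 : x 0 = 1)
    (hrec : ∀ n, x (n + 1) = ∑ k ∈ Finset.range (n + 1), (n.choose k : ℂ) * f (k + 1) * x (n - k))
    (hfull : ∀ (α : Type) [Fintype α] [DecidableEq α] (key : α → ℕ) (e : List α),
      (e.Pairwise fun a b => key a < key b) → (∀ a, a ∈ e) → Fintype.card α ≤ N →
        fullSum A B key e = x (Fintype.card α))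
    (n : ℕ) (α : Type) [Fintype α] [DecidableEq α] (key : α → ℕ) (e : List α)
    (he : e.Pairwise fun a b => key a < key b) (hc : ∀ a, a ∈ e)
    (hn : Fintype.card α = n + 1) (hN : Fintype.card α ≤ N) :
    connSum A B key e = f (n + 1) := by
  induction n using Nat.strong_induction_on generalizing α with
  | _ n ih =>
    obtain ⟨s₀⟩ : Nonempty α := Fintype.card_pos_iff.mp (by omega)
    have h := fullSum_eq_connSum_add A B key e hN s₀
    have h2 : ∑ T ∈ Finset.univ.filter (fun T : Finset α => s₀ ∈ T ∧ T ≠ Finset.univ),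
        connSum A B (fun a : {a // a ∈ T} => key a) (subList (· ∈ T) e) *
          fullSum A B (fun a : {a // a ∉ T} => key a) (subList (· ∉ T) e) =
        ∑ T ∈ Finset.univ.filter (fun T : Finset α => s₀ ∈ T ∧ T ≠ Finset.univ),
          f T.card * x (n + 1 - T.card) := by
      refine Finset.sum_congr rfl fun T hT => ?_
      obtain ⟨hs₀, hne⟩ := (Finset.mem_filter.mp hT).2
      have hlt : T.card < n + 1 := by
        rw [← hn, ← Finset.card_univ]
        exact Finset.card_lt_card (Finset.ssubset_univ_iff.mpr hne)
      have hpos : 0 < T.card := Finset.card_pos.mpr ⟨s₀, hs₀⟩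
      have hc1 : Fintype.card {a // a ∈ T} = T.card := Fintype.card_coe T
      have hc2 : Fintype.card {a // a ∉ T} = n + 1 - T.card := by
        rw [Fintype.card_subtype_compl, hn, hc1]
      rw [ih (T.card - 1) (by omega) {a // a ∈ T} (fun a => key a) (subList (· ∈ T) e)
        (pairwise_subList _ e key he) (fun a => mem_subList _ e a (hc a)) (by omega) (by omega),
        hfull {a // a ∉ T} (fun a => key a) (subList (· ∉ T) e)
        (pairwise_subList _ e key he) (fun a => mem_subList _ e a (hc a)) (by omega), hc2,
        Nat.sub_add_cancel hpos]
    have h3 := sum_filter_mem_card s₀ n hn fun k => f k * x (n + 1 - k)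
    have h4 : Finset.univ.filter (fun T : Finset α => s₀ ∈ T) =
        insert Finset.univ (Finset.univ.filter fun T : Finset α => s₀ ∈ T ∧ T ≠ Finset.univ) := by
      ext T
      by_cases hT : T = Finset.univ <;> simp [hT]
    rw [h4, Finset.sum_insert (by simp), Finset.card_univ, hn, Nat.sub_self, hx0, mul_one] at h3
    rw [h2, hfull α key e he hc hN, hn, hrec] at h
    have h5 : ∀ k, (n.choose k : ℂ) * (f (k + 1) * x (n + 1 - (k + 1))) =
        (n.choose k : ℂ) * f (k + 1) * x (n - k) := by
      intro k
      rw [Nat.add_sub_add_right, mul_assoc]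
    simp only [h5] at h3
    rw [← h3] at h
    exact (add_right_cancel h).symm

lemma hasDerivAt_integral_exp {Ω : Type*} [MeasurableSpace Ω] (μ : Measure Ω)
    [IsFiniteMeasure μ] (g : Ω → ℂ) (hg : AEStronglyMeasurable g μ) (C : ℝ)
    (hC : ∀ ω, ‖g ω‖ ≤ C) (n : ℕ) (z : ℂ) :
    HasDerivAt (fun z => ∫ ω, g ω ^ n * Complex.exp (z * g ω) ∂μ)
      (∫ ω, g ω ^ (n + 1) * Complex.exp (z * g ω) ∂μ) z := by
  have hmeas : ∀ (m : ℕ) (z : ℂ),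
      AEStronglyMeasurable (fun ω => g ω ^ m * Complex.exp (z * g ω)) μ := fun m z =>
    (hg.pow m).mul (Complex.continuous_exp.comp_aestronglyMeasurable (hg.const_mul z))
  have hbound : ∀ (m : ℕ) (z : ℂ) (ω : Ω), ‖g ω ^ m * Complex.exp (z * g ω)‖ ≤
      C ^ m * Real.exp (‖z‖ * C) := by
    intro m z ω
    rw [norm_mul, norm_pow, Complex.norm_exp]
    have hC0 : 0 ≤ C := (norm_nonneg _).trans (hC ω)
    gcongr
    · exact hC ω
    · refine (Complex.re_le_norm _).trans ?_
      rw [norm_mul]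
      exact mul_le_mul_of_nonneg_left (hC ω) (norm_nonneg _)
  refine (hasDerivAt_integral_of_dominated_loc_of_deriv_le (s := Metric.ball z 1)
    (F := fun z ω => g ω ^ n * Complex.exp (z * g ω))
    (F' := fun z ω => g ω ^ (n + 1) * Complex.exp (z * g ω))
    (bound := fun _ => C ^ (n + 1) * Real.exp ((‖z‖ + 1) * C))
    (Metric.ball_mem_nhds z one_pos) (Filter.Eventually.of_forall fun z => hmeas n z) ?_
    (hmeas _ z) ?_ (integrable_const _) ?_).2
  · exact Integrable.of_bound (hmeas n z) _ (Filter.Eventually.of_forall (hbound n z))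
  · refine Filter.Eventually.of_forall fun ω y hy => (hbound (n + 1) y ω).trans ?_
    have hC0 : 0 ≤ C := (norm_nonneg _).trans (hC ω)
    have : ‖y‖ ≤ ‖z‖ + 1 := by
      have := norm_sub_norm_le y z
      rw [Metric.mem_ball, dist_eq_norm] at hy
      linarith
    gcongr
  · refine Filter.Eventually.of_forall fun ω y _ => ?_
    have h1 : HasDerivAt (fun y => y * g ω) (g ω) y := by
      simpa using (hasDerivAt_id y).mul_const (g ω)
    have h2 := (h1.cexp).const_mul (g ω ^ n)
    rw [pow_succ, mul_assoc, mul_comm (g ω) (Complex.exp _)]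
    exact h2

lemma iteratedDeriv_integral_exp {Ω : Type*} [MeasurableSpace Ω] (μ : Measure Ω)
    [IsFiniteMeasure μ] (g : Ω → ℂ) (hg : AEStronglyMeasurable g μ) (C : ℝ)
    (hC : ∀ ω, ‖g ω‖ ≤ C) (n : ℕ) :
    iteratedDeriv n (fun z => ∫ ω, Complex.exp (z * g ω) ∂μ) =
      fun z => ∫ ω, g ω ^ n * Complex.exp (z * g ω) ∂μ := by
  induction n with
  | zero => simp
  | succ n ih =>
    rw [iteratedDeriv_succ, ih]
    funext z
    exact (hasDerivAt_integral_exp μ g hg C hC n z).deriv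

lemma hciz_eq {N : ℕ} (μ : Measure (Matrix.unitaryGroup (Fin N) ℂ))
    (A B : Matrix (Fin N) (Fin N) ℂ) :
    hciz μ A B = fun z => ∫ U, Complex.exp (z * (-(N : ℂ) * (A * conjMat B U).trace)) ∂μ := by
  funext z
  refine integral_congr_ae (Filter.Eventually.of_forall fun U => ?_)
  simp only [conjMat, mul_assoc, mul_neg, neg_mul]

lemma continuous_trace_conjMat {N : ℕ} (A B : Matrix (Fin N) (Fin N) ℂ) :
    Continuous fun U => (A * conjMat B U).trace :=
  (continuous_const.mul (continuous_conjMat B)).matrix_trace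

lemma norm_trace_conjMat_le {N : ℕ} (A B : Matrix (Fin N) (Fin N) ℂ) :
    ∃ C : ℝ, ∀ U, ‖(A * conjMat B U).trace‖ ≤ C := by
  obtain ⟨C, hC0, hC⟩ := norm_conjMat_le B
  refine ⟨∑ i, ∑ j, ‖A i j‖ * C, fun U => ?_⟩
  rw [Matrix.trace]
  refine (norm_sum_le _ _).trans (Finset.sum_le_sum fun i _ => ?_)
  rw [Matrix.diag_apply, Matrix.mul_apply]
  refine (norm_sum_le _ _).trans (Finset.sum_le_sum fun j _ => ?_)
  rw [norm_mul]
  exact mul_le_mul_of_nonneg_left (hC _ _ _) (norm_nonneg _)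

lemma iteratedDeriv_hciz {N : ℕ} (μ : Measure (Matrix.unitaryGroup (Fin N) ℂ))
    [IsProbabilityMeasure μ] (A B : Matrix (Fin N) (Fin N) ℂ) (n : ℕ) :
    Differentiable ℂ (hciz μ A B) ∧ iteratedDeriv n (hciz μ A B) 0 =
      (-1) ^ n * ((N : ℂ) ^ n * ∫ U, (A * conjMat B U).trace ^ n ∂μ) := by
  obtain ⟨C, hC⟩ := norm_trace_conjMat_le A B
  have hm : AEStronglyMeasurable (fun U => -(N : ℂ) * (A * conjMat B U).trace) μ :=
    (continuous_const.mul (continuous_trace_conjMat A B)).aestronglyMeasurable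
  have hb : ∀ U, ‖-(N : ℂ) * (A * conjMat B U).trace‖ ≤ N * C := by
    intro U
    rw [norm_mul, norm_neg, Complex.norm_natCast]
    exact mul_le_mul_of_nonneg_left (hC U) (Nat.cast_nonneg _)
  rw [hciz_eq]
  constructor
  · intro z
    have := (hasDerivAt_integral_exp μ _ hm _ hb 0 z).differentiableAt
    simpa using this
  · rw [iteratedDeriv_integral_exp μ _ hm _ hb]
    simp only [zero_mul, Complex.exp_zero, mul_one, mul_pow, neg_pow (N : ℂ)]
    rw [integral_const_mul, mul_assoc]

lemma connSum_eq_iteratedDeriv {N : ℕ} (hN0 : 0 < N)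
    (μ : Measure (Matrix.unitaryGroup (Fin N) ℂ)) [IsProbabilityMeasure μ] [μ.IsMulLeftInvariant]
    (A B : Matrix (Fin N) (Fin N) ℂ) (r : ℝ) (hr : 0 < r) (F : ℂ → ℂ)
    (hF : IsFreeEnergyBranch μ A B r F) (n : ℕ) (α : Type) [Fintype α] [DecidableEq α]
    (key : α → ℕ) (e : List α) (he : e.Pairwise fun a b => key a < key b) (hc : ∀ a, a ∈ e)
    (hn : Fintype.card α = n + 1) (hN : Fintype.card α ≤ N) :
    connSum A B key e = (-1) ^ (n + 1) * ((N : ℂ) ^ 2 * iteratedDeriv (n + 1) F 0) := by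
  obtain ⟨hFd, hF0, hFe⟩ := hF
  set I := hciz μ A B with hI
  have hId : Differentiable ℂ I := (iteratedDeriv_hciz μ A B 0).1
  have hball : Metric.ball (0 : ℂ) r ∈ nhds (0 : ℂ) := Metric.ball_mem_nhds 0 hr
  have hderiv : deriv I =ᶠ[nhds 0] (fun z => (N : ℂ) ^ 2 * deriv F z) * I := by
    filter_upwards [Metric.isOpen_ball.mem_nhds (Metric.mem_ball_self hr)] with z hz
    have hnz := Metric.isOpen_ball.mem_nhds hz
    have h1 : I =ᶠ[nhds z] fun z => Complex.exp ((N : ℂ) ^ 2 * F z) := by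
      filter_upwards [hnz] with w hw
      exact (hFe w hw).symm
    have h2 := (((hFd.differentiableAt hnz).hasDerivAt).const_mul ((N : ℂ) ^ 2)).cexp
    rw [h1.deriv_eq, h2.deriv, Pi.mul_apply, hFe z hz, mul_comm]
  have hFan : AnalyticAt ℂ F 0 := hFd.analyticAt hball
  have hrecI : ∀ m, iteratedDeriv (m + 1) I 0 = ∑ k ∈ Finset.range (m + 1), (m.choose k : ℂ) *
      ((N : ℂ) ^ 2 * iteratedDeriv (k + 1) F 0) * iteratedDeriv (m - k) I 0 := by
    intro m
    rw [iteratedDeriv_succ', hderiv.iteratedDeriv_eq m, iteratedDeriv_mul]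
    · refine Finset.sum_congr rfl fun k _ => ?_
      have : iteratedDeriv k (fun z => (N : ℂ) ^ 2 * deriv F z) 0 =
          (N : ℂ) ^ 2 * iteratedDeriv (k + 1) F 0 := by
        rw [iteratedDeriv_const_mul_field, iteratedDeriv_succ']
      rw [this]
    · exact (analyticAt_const.mul hFan.deriv).contDiffAt
    · exact (hId.analyticAt 0).contDiffAt
  have hI0 : I 0 = 1 := by
    rw [← hFe 0 (Metric.mem_ball_self hr), hF0]; simp
  refine connSum_eq_of_recurrence A B (fun m => (-1) ^ m * iteratedDeriv m I 0)
    (fun m => (-1) ^ m * ((N : ℂ) ^ 2 * iteratedDeriv m F 0)) (by simp [hI0]) ?_ ?_ n α key e he hc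
    hn hN
  · intro m
    rw [hrecI, Finset.mul_sum]
    refine Finset.sum_congr rfl fun k hk => ?_
    have hk : k ≤ m := Nat.lt_succ_iff.mp (Finset.mem_range.mp hk)
    have : (-1 : ℂ) ^ (m + 1) = (-1) ^ (k + 1) * (-1) ^ (m - k) := by
      rw [← pow_add]; congr 1; omega
    rw [this]
    ring
  · intro β _ _ key' e' he' hc' hN'
    rw [← pow_mul_integral_trace_pow hN0 μ A B key' hN' e' he' hc',
      (iteratedDeriv_hciz μ A B _).2, ← mul_assoc, ← pow_add, Even.neg_one_pow ⟨_, rfl⟩, one_mul]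

lemma sum_prod_path {N : ℕ} (A : Matrix (Fin N) (Fin N) ℂ) (n : ℕ) (g : Fin N → Fin N → ℂ) :
    ∑ i : Fin (n + 1) → Fin N, (∏ k : Fin n, A (i k.castSucc) (i k.succ)) *
      g (i (Fin.last n)) (i 0) = ∑ a, ∑ b, (A ^ n) a b * g b a := by
  induction n generalizing g with
  | zero =>
    rw [← (Equiv.funUnique (Fin 1) (Fin N)).symm.sum_comp]
    simp [Matrix.one_apply]
  | succ n ih =>
    rw [← (Fin.consEquiv fun _ : Fin (n + 2) => Fin N).sum_comp, Fintype.sum_prod_type]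
    refine Finset.sum_congr rfl fun a _ => ?_
    have := ih (fun b c => A a c * g b a)
    simp only [Fin.consEquiv, Equiv.coe_fn_mk, Fin.prod_univ_succ, Fin.castSucc_zero,
      Fin.cons_zero, Fin.cons_succ, ← Fin.succ_castSucc, ← Fin.succ_last]
    calc _ = ∑ x : Fin (n + 1) → Fin N, (∏ k : Fin n, A (x k.castSucc) (x k.succ)) *
          (A a (x 0) * g (x (Fin.last n)) a) := Finset.sum_congr rfl fun x _ => by ring
      _ = _ := by
        rw [this, Finset.sum_comm]
        refine Finset.sum_congr rfl fun b _ => ?_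
        rw [pow_succ', Matrix.mul_apply, Finset.sum_mul]
        refine Finset.sum_congr rfl fun c _ => by ring

lemma permTr_of_enum {α : Type*} [Fintype α] [DecidableEq α] {N n : ℕ}
    (A : Matrix (Fin N) (Fin N) ℂ) (π : Equiv.Perm α) (f : Fin (n + 1) ≃ α)
    (h : ∀ k : Fin n, π (f k.castSucc) = f k.succ) (hl : π (f (Fin.last n)) = f 0) :
    permTr A π = (A ^ (n + 1)).trace := by
  have := sum_prod_path A n A
  rw [permTr, ← (Equiv.arrowCongr f (Equiv.refl (Fin N))).sum_comp]
  rw [show (A ^ (n + 1)).trace = ∑ a, ∑ b, (A ^ n) a b * A b a by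
    rw [pow_succ, Matrix.trace]; simp [Matrix.mul_apply], ← this]
  refine Finset.sum_congr rfl fun i _ => ?_
  rw [← f.prod_comp, Fin.prod_univ_castSucc]
  simp [h, hl]

lemma exists_enum_of_sameCycle {α : Type*} [Fintype α] [DecidableEq α] (π : Equiv.Perm α) (s₀ : α)
    (hs : ∀ s, π.SameCycle s₀ s) (n : ℕ) (hn : Fintype.card α = n + 1) :
    ∃ f : Fin (n + 1) ≃ α, (∀ k : Fin n, π (f k.castSucc) = f k.succ) ∧
      π (f (Fin.last n)) = f 0 := by
  set f : Fin (n + 1) → α := fun k => (π ^ (k : ℕ)) s₀ with hf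
  have hlt : ∀ s, ∃ i < n + 1, (π ^ i) s₀ = s := by
    intro s
    by_cases h0 : s₀ ∈ π.support
    · obtain ⟨i, hi, rfl⟩ := (hs s).exists_pow_eq_of_mem_support h0
      exact ⟨i, hi.trans_le (hn ▸ Finset.card_le_univ _), rfl⟩
    · refine ⟨0, by omega, ?_⟩
      simp only [Equiv.Perm.mem_support, not_not] at h0
      obtain ⟨i, rfl⟩ := hs s
      simp [Equiv.Perm.zpow_apply_eq_self_of_apply_eq_self h0]
  have hsurj : Function.Surjective f := fun s => by
    obtain ⟨i, hi, h⟩ := hlt s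
    exact ⟨⟨i, hi⟩, h⟩
  have hbij : Function.Bijective f :=
    (Fintype.bijective_iff_surjective_and_card f).2 ⟨hsurj, by simp [hn]⟩
  refine ⟨Equiv.ofBijective f hbij, fun k => ?_, ?_⟩
  · simp [hf, pow_succ']
  · simp only [Equiv.ofBijective_apply]
    obtain ⟨j, hj⟩ := hsurj (π (f (Fin.last n)))
    rcases Fin.eq_zero_or_eq_succ j with rfl | ⟨k, rfl⟩
    · exact hj.symm
    · exfalso
      have : π (f k.castSucc) = π (f (Fin.last n)) := by rw [← hj]; simp [hf, pow_succ']
      have := hbij.1 (π.injective this)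
      exact (Fin.castSucc_lt_last k).ne this

lemma partition_parts_of_sameCycle {α : Type*} [Fintype α] [DecidableEq α] (π : Equiv.Perm α)
    (s₀ : α) (hs : ∀ s, π.SameCycle s₀ s) : π.partition.parts = {Fintype.card α} := by
  rw [Equiv.Perm.parts_partition]
  by_cases h : π s₀ = s₀
  · have hall : ∀ s, s = s₀ := fun s => by
      obtain ⟨i, rfl⟩ := hs s
      simp [Equiv.Perm.zpow_apply_eq_self_of_apply_eq_self h]
    have h1 : π = 1 := Equiv.ext fun s => by rw [hall s, h]; rfl
    have hc : Fintype.card α = 1 := Fintype.card_eq_one_iff.2 ⟨s₀, hall⟩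
    simp [h1, hc]
  · have hcyc : π.IsCycle := ⟨s₀, h, fun y _ => hs y⟩
    have hsupp : π.support = Finset.univ := by
      ext s
      simp only [Equiv.Perm.mem_support, Finset.mem_univ, iff_true]
      exact fun hh => h (((hs s).apply_eq_self_iff).2 hh)
    simp [hcyc.cycleType, hsupp]

lemma partition_parts_subtypeCongr {α : Type*} [Fintype α] [DecidableEq α] (p : α → Prop)
    [DecidablePred p] (ρ₁ : Equiv.Perm {s // p s}) (ρ₂ : Equiv.Perm {s // ¬ p s}) :
    (Equiv.Perm.subtypeCongr ρ₁ ρ₂).partition.parts = ρ₁.partition.parts + ρ₂.partition.parts := by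
  have h : Equiv.Perm.subtypeCongr ρ₁ ρ₂ =
      Equiv.Perm.ofSubtype ρ₁ * Equiv.Perm.ofSubtype ρ₂ := by
    ext s
    by_cases hs : p s
    · have : Equiv.Perm.ofSubtype ρ₂ s = s :=
        Equiv.Perm.ofSubtype_apply_of_not_mem ρ₂ (by simpa using hs)
      simp [hs, this, Equiv.Perm.ofSubtype_apply_of_mem ρ₁ hs]
    · have : Equiv.Perm.ofSubtype ρ₂ s = ρ₂ ⟨s, hs⟩ := Equiv.Perm.ofSubtype_apply_of_mem ρ₂ hs
      rw [Equiv.Perm.mul_apply, this,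
        Equiv.Perm.ofSubtype_apply_of_not_mem ρ₁ (ρ₂ ⟨s, hs⟩).2]
      simp [hs]
  have hd : (Equiv.Perm.ofSubtype ρ₁).Disjoint (Equiv.Perm.ofSubtype ρ₂) := by
    intro s
    by_cases hs : p s
    · exact Or.inr (Equiv.Perm.ofSubtype_apply_of_not_mem ρ₂ (by simpa using hs))
    · exact Or.inl (Equiv.Perm.ofSubtype_apply_of_not_mem ρ₁ hs)
  have hct : (Equiv.Perm.subtypeCongr ρ₁ ρ₂).cycleType = ρ₁.cycleType + ρ₂.cycleType := by
    rw [h, hd.cycleType_mul, Equiv.Perm.cycleType_ofSubtype, Equiv.Perm.cycleType_ofSubtype]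
  have hcard : Fintype.card α = Fintype.card {s // p s} + Fintype.card {s // ¬ p s} := by
    rw [← Fintype.card_sum]; exact Fintype.card_congr (Equiv.sumCompl p).symm
  have h1 := Finset.card_le_univ ρ₁.support
  have h2 := Finset.card_le_univ ρ₂.support
  simp only [Equiv.Perm.parts_partition, ← Equiv.Perm.sum_cycleType] at *
  rw [hct, Multiset.sum_add, hcard, show ∀ a b c d : ℕ, c ≤ a → d ≤ b →
    a + b - (c + d) = (a - c) + (b - d) from fun a b c d _ _ => by omega, Multiset.replicate_add]
  · abel
  · exact h1
  · exact h2

/-- The trace of a product tensor against a permutation is the product, over the cycles, of traces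
of powers. -/
theorem permTr_eq_prod {α : Type*} [Fintype α] [DecidableEq α] {N : ℕ}
    (A : Matrix (Fin N) (Fin N) ℂ) (π : Equiv.Perm α) :
    permTr A π = (π.partition.parts.map fun k => (A ^ k).trace).prod := by
  classical
  obtain ⟨m, hm⟩ : ∃ m, Fintype.card α = m := ⟨_, rfl⟩
  induction m using Nat.strong_induction_on generalizing α with
  | _ m ih =>
    rcases isEmpty_or_nonempty α with hα | ⟨⟨s₀⟩⟩
    · have : π = 1 := Subsingleton.elim _ _
      subst this
      simp [permTr, Equiv.Perm.parts_partition]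
    · by_cases hall : ∀ s, π.SameCycle s₀ s
      · obtain ⟨n, hn⟩ : ∃ n, Fintype.card α = n + 1 :=
          Nat.exists_eq_succ_of_ne_zero (haveI : Nonempty α := ⟨s₀⟩; Fintype.card_ne_zero)
        obtain ⟨f, h1, h2⟩ := exists_enum_of_sameCycle π s₀ hall n hn
        rw [permTr_of_enum A π f h1 h2, partition_parts_of_sameCycle π s₀ hall, hn]
        simp
      · push Not at hall
        obtain ⟨s₁, hs₁⟩ := hall
        set p : α → Prop := π.SameCycle s₀ with hp
        have hpp : ∀ s, p (π s) ↔ p s := fun s => Equiv.Perm.sameCycle_apply_right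
        have hnp : ∀ s, ¬ p (π s) ↔ ¬ p s := fun s => not_congr (hpp s)
        have hπ : π = Equiv.Perm.subtypeCongr (π.subtypePerm hpp) (π.subtypePerm hnp) := by
          ext s
          by_cases hs : p s
          · simp [hs]
          · simp [hs]
        have c1 : Fintype.card {s // p s} < m := by
          rw [← hm]; exact Fintype.card_subtype_lt (x := s₁) hs₁
        have c2 : Fintype.card {s // ¬ p s} < m := by
          rw [← hm]
          exact Fintype.card_subtype_lt (x := s₀) (not_not.2 (Equiv.Perm.SameCycle.refl π s₀))
        conv_lhs => rw [hπ]
        conv_rhs => rw [hπ]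
        rw [permTr_subtypeCongr, partition_parts_subtypeCongr, Multiset.map_add, Multiset.prod_add,
          ih _ c1 _ rfl, ih _ c2 _ rfl]

/-- The functions to `ZMod 2` invariant under `σ` and under the swaps of the pairs in `ws`. -/
def fixSpace {α : Type*} (σ : Equiv.Perm α) (ws : List (α × α)) :
    Submodule (ZMod 2) (α → ZMod 2) where
  carrier := {f | (∀ s, f (σ s) = f s) ∧ ∀ w ∈ ws, f w.1 = f w.2}
  add_mem' := fun {f g} hf hg => ⟨fun s => by simp [hf.1 s, hg.1 s],
    fun w hw => by simp [hf.2 w hw, hg.2 w hw]⟩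
  zero_mem' := ⟨fun _ => rfl, fun _ _ => rfl⟩
  smul_mem' := fun c f hf => ⟨fun s => by simp [hf.1 s], fun w hw => by simp [hf.2 w hw]⟩

lemma mem_fixSpace {α : Type*} {σ : Equiv.Perm α} {ws : List (α × α)} {f : α → ZMod 2} :
    f ∈ fixSpace σ ws ↔ (∀ s, f (σ s) = f s) ∧ ∀ w ∈ ws, f w.1 = f w.2 := Iff.rfl

/-- The product of the transpositions of a list of pairs. -/
def swapsProd {α : Type*} [DecidableEq α] (ws : List (α × α)) : Equiv.Perm α :=
  (ws.map fun w => Equiv.swap w.1 w.2).prod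

lemma apply_swap_of_eq {α β : Type*} [DecidableEq α] {f : α → β} {a b : α} (h : f a = f b)
    (s : α) : f (Equiv.swap a b s) = f s := by
  rcases eq_or_ne s a with rfl | ha
  · simp [h]
  rcases eq_or_ne s b with rfl | hb
  · simp [h]
  rw [Equiv.swap_apply_of_ne_of_ne ha hb]

lemma fixSpace_le_mul_swap {α : Type*} [DecidableEq α] (π : Equiv.Perm α) (w : α × α) :
    fixSpace π [w] ≤ fixSpace (π * Equiv.swap w.1 w.2) [w] := by
  intro f hf
  refine ⟨fun s => ?_, hf.2⟩
  rw [Equiv.Perm.mul_apply, hf.1, apply_swap_of_eq (hf.2 w (by simp))]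

lemma fixSpace_mul_swap {α : Type*} [DecidableEq α] (π : Equiv.Perm α) (w : α × α) :
    fixSpace (π * Equiv.swap w.1 w.2) [w] = fixSpace π [w] := by
  refine le_antisymm ?_ (fixSpace_le_mul_swap π w)
  have := fixSpace_le_mul_swap (π * Equiv.swap w.1 w.2) w
  rwa [mul_assoc, Equiv.swap_mul_self, mul_one] at this

lemma fixSpace_le_mul_swapsProd {α : Type*} [DecidableEq α] (σ : Equiv.Perm α)
    (ws : List (α × α)) : fixSpace σ ws ≤ fixSpace (σ * swapsProd ws) [] := by
  intro f hf
  refine ⟨fun s => ?_, by simp⟩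
  rw [Equiv.Perm.mul_apply, hf.1]
  have h2 := hf.2
  clear hf
  induction ws generalizing s with
  | nil => simp [swapsProd]
  | cons w ws ih =>
    simp only [swapsProd, List.map_cons, List.prod_cons, Equiv.Perm.mul_apply] at ih ⊢
    rw [apply_swap_of_eq (h2 w (by simp)), ih s fun v hv => h2 v (by simp [hv])]

lemma finrank_fixSpace {α : Type*} [Fintype α] [DecidableEq α] (π : Equiv.Perm α) :
    Module.finrank (ZMod 2) (fixSpace π []) = π.partition.parts.card := by
  have h1 : (Nat.card (fixSpace π []) : ℂ) = 2 ^ π.partition.parts.card := by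
    have h2 := permTr_eq_prod (1 : Matrix (Fin 2) (Fin 2) ℂ) π
    rw [← colorCount_univ 0, colorCount, if_pos (by simp)] at h2
    have : Nat.card (fixSpace π []) = Nat.card (InvColoring (0 : Fin 2) Finset.univ π) :=
      Nat.card_congr (Equiv.subtypeEquivRight fun f => by
        simp only [Finset.mem_univ, not_true, IsEmpty.forall_iff, implies_true, and_true]
        exact ⟨fun h => h.1, fun h => ⟨h, by simp⟩⟩)
    rw [this, h2]
    simp
  have h3 := Module.natCard_eq_pow_finrank (K := ZMod 2) (V := fixSpace π [])
  rw [Nat.card_zmod] at h3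
  rw [h3] at h1
  exact Nat.pow_right_injective le_rfl (by exact_mod_cast h1)

lemma finrank_fixSpace_cons {α : Type*} [Fintype α] (σ : Equiv.Perm α)
    (ws : List (α × α)) (w : α × α) :
    Module.finrank (ZMod 2) (fixSpace σ ws) ≤
      Module.finrank (ZMod 2) (fixSpace σ (w :: ws)) + 1 := by
  set φ : fixSpace σ ws →ₗ[ZMod 2] ZMod 2 :=
    ((LinearMap.proj (φ := fun _ : α => ZMod 2) w.1 : (α → ZMod 2) →ₗ[ZMod 2] ZMod 2) -
      LinearMap.proj (φ := fun _ : α => ZMod 2) w.2).comp (fixSpace σ ws).subtype with hφ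
  have h1 := φ.finrank_range_add_finrank_ker
  have h2 : Module.finrank (ZMod 2) φ.range ≤ 1 :=
    (Submodule.finrank_le _).trans (Module.finrank_self _).le
  have h3 : Module.finrank (ZMod 2) φ.ker ≤
      Module.finrank (ZMod 2) (fixSpace σ (w :: ws)) := by
    rw [← Submodule.finrank_map_subtype_eq]
    refine Submodule.finrank_mono ?_
    rintro _ ⟨f, hf, rfl⟩
    refine ⟨f.2.1, fun v hv => ?_⟩
    rcases List.mem_cons.1 hv with rfl | hv
    · exact sub_eq_zero.1 hf
    · exact f.2.2 v hv
  omega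

lemma sign_eq_neg_one_pow {α : Type*} [Fintype α] [DecidableEq α] (π : Equiv.Perm α) :
    (Equiv.Perm.sign π : ℤ) = (-1) ^ (Fintype.card α + π.partition.parts.card) := by
  have := Finset.card_le_univ π.support
  rw [Equiv.Perm.sign_of_cycleType, Equiv.Perm.sum_cycleType, Equiv.Perm.parts_partition,
    Multiset.card_add, Multiset.card_replicate]
  push_cast
  rw [show Fintype.card α + (π.cycleType.card + (Fintype.card α - π.support.card)) =
    (π.support.card + π.cycleType.card) + 2 * (Fintype.card α - π.support.card) by omega,
    pow_add _ _ (2 * _), pow_mul]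
  simp

lemma card_parts_mul_swap_le {α : Type*} [Fintype α] [DecidableEq α] (π : Equiv.Perm α)
    (w : α × α) :
    (π * Equiv.swap w.1 w.2).partition.parts.card ≤
      Module.finrank (ZMod 2) (fixSpace π [w]) + 1 := by
  rw [← finrank_fixSpace, ← fixSpace_mul_swap]
  exact finrank_fixSpace_cons _ _ _

lemma fixSpace_cons_le {α : Type*} (σ : Equiv.Perm α) (ws : List (α × α)) (w : α × α) :
    fixSpace σ (w :: ws) ≤ fixSpace σ ws :=
  fun _ hf => ⟨hf.1, fun v hv => hf.2 v (List.mem_cons_of_mem _ hv)⟩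

/-- An inequality of Riemann–Hurwitz type. -/
theorem card_parts_add_le {α : Type*} [Fintype α] [DecidableEq α] (σ : Equiv.Perm α)
    (ws : List (α × α)) (hws : ∀ w ∈ ws, w.1 ≠ w.2) :
    σ.partition.parts.card + (σ * swapsProd ws).partition.parts.card ≤
      ws.length + 2 * Module.finrank (ZMod 2) (fixSpace σ ws) := by
  induction ws using List.reverseRecOn with
  | nil => simp [swapsProd, finrank_fixSpace]; omega
  | append_singleton ws w ih =>
    have ih := ih fun v hv => hws v (by simp [hv])
    have hV : fixSpace σ (ws ++ [w]) = fixSpace σ (w :: ws) := by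
      ext f
      have : ∀ v, v ∈ ws ++ [w] ↔ v ∈ w :: ws := fun v => by simp [or_comm]
      simp only [mem_fixSpace, this]
    have hprod : σ * swapsProd (ws ++ [w]) = σ * swapsProd ws * Equiv.swap w.1 w.2 := by
      simp [swapsProd, mul_assoc]
    rw [hV, hprod, List.length_append, List.length_singleton]
    set π := σ * swapsProd ws with hπ
    have hfπ := finrank_fixSpace π
    have hle := card_parts_mul_swap_le π w
    have hmono := Submodule.finrank_mono (fixSpace_cons_le π [] w)
    by_cases hH : fixSpace σ ws ≤ fixSpace σ (w :: ws)
    · rw [le_antisymm (fixSpace_cons_le σ ws w) hH]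
      omega
    · have hlt : fixSpace π [w] < fixSpace π [] := by
        refine lt_of_le_of_ne (fixSpace_cons_le π [] w) fun heq => hH fun f hf => ?_
        have : f ∈ fixSpace π [w] := heq ▸ fixSpace_le_mul_swapsProd σ ws hf
        refine ⟨hf.1, fun v hv => ?_⟩
        rcases List.mem_cons.1 hv with rfl | hv
        · exact this.2 v (by simp)
        · exact hf.2 v hv
      have hlt' := Submodule.finrank_lt_finrank_of_lt hlt
      have hcons := finrank_fixSpace_cons σ ws w
      have hpar : (π * Equiv.swap w.1 w.2).partition.parts.card ≠ π.partition.parts.card := by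
        intro heq
        have h1 := sign_eq_neg_one_pow (π * Equiv.swap w.1 w.2)
        rw [heq, ← sign_eq_neg_one_pow π, Equiv.Perm.sign_mul,
          Equiv.Perm.sign_swap (hws w (by simp))] at h1
        rcases Int.units_eq_one_or (Equiv.Perm.sign π) with h | h <;> rw [h] at h1 <;>
          simp at h1
      omega

/-- The list of pairs encoded by a family of words. -/
def famPairs {d : ℕ} (L : Fin d → List (Fin d)) : List (Fin d × Fin d) :=
  (List.finRange d).flatMap fun b => (L b).map fun a => (a, b)

lemma mem_famPairs {d : ℕ} {L : Fin d → List (Fin d)} {w : Fin d × Fin d} :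
    w ∈ famPairs L ↔ w.1 ∈ L w.2 := by
  obtain ⟨a, b⟩ := w
  simp [famPairs]

lemma filter_famPairs {d : ℕ} (L : Fin d → List (Fin d)) (b : Fin d) :
    ((famPairs L).filter fun w => w.2 = b).map Prod.fst = L b := by
  have h : ∀ e : List (Fin d), e.Nodup →
      ((e.flatMap fun b => (L b).map fun a => (a, b)).filter fun w => w.2 = b).map Prod.fst =
        if b ∈ e then L b else [] := by
    intro e he
    induction e with
    | nil => simp
    | cons c e ih =>
      rw [List.nodup_cons] at he
      rw [List.flatMap_cons, List.filter_append, List.map_append, ih he.2]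
      by_cases hc : c = b
      · subst hc
        simp [he.1, List.filter_map, Function.comp_def]
      · simp [hc, Ne.symm hc, List.filter_map, Function.comp_def]
  rw [famPairs, h _ (List.nodup_finRange d), if_pos (List.mem_finRange b)]

lemma famPairs_injective {d : ℕ} : Function.Injective (famPairs (d := d)) := fun L L' h =>
  funext fun b => by rw [← filter_famPairs L b, h, filter_famPairs]

lemma filter_append_filter {β : Type*} {d : ℕ} (key : β → Fin d) (b : Fin d) (ws : List β)
    (hs : ws.Pairwise fun v w => key v ≤ key w) (hb : ∀ w ∈ ws, b ≤ key w) :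
    (ws.filter fun w => key w = b) ++ (ws.filter fun w => key w ≠ b) = ws := by
  induction ws with
  | nil => rfl
  | cons w ws ih =>
    rw [List.pairwise_cons] at hs
    by_cases h : key w = b
    · have := ih hs.2 fun v hv => hb v (by simp [hv])
      simpa [h] using this
    · have hlt : b < key w := lt_of_le_of_ne (hb w (by simp)) (Ne.symm h)
      have hne : ∀ v ∈ w :: ws, key v ≠ b := by
        intro v hv
        rcases List.mem_cons.1 hv with rfl | hv
        · exact h
        · exact (hlt.trans_le (hs.1 v hv)).ne'
      rw [List.filter_eq_nil_iff.2 (by simpa using hne),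
        List.filter_eq_self.2 (by simpa using hne), List.nil_append]

lemma flatMap_filter_eq {β : Type*} {d : ℕ} (key : β → Fin d) (e : List (Fin d))
    (he : e.Pairwise (· < ·)) (ws : List β)
    (hs : ws.Pairwise fun v w => key v ≤ key w) (hb : ∀ w ∈ ws, key w ∈ e) :
    (e.flatMap fun b => ws.filter fun w => key w = b) = ws := by
  induction e generalizing ws with
  | nil =>
    cases ws with
    | nil => rfl
    | cons w ws => simpa using hb w
  | cons b e ih =>
    rw [List.pairwise_cons] at he
    have h1 := ih he.2 (ws.filter fun w => key w ≠ b) (hs.filter _) (by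
      intro w hw
      rw [List.mem_filter] at hw
      rcases List.mem_cons.1 (hb w hw.1) with h | h
      · simp [h] at hw
      · exact h)
    have h2 : (e.flatMap fun c => ws.filter fun w => key w = c) =
        e.flatMap fun c => (ws.filter fun w => key w ≠ b).filter fun w => key w = c := by
      refine List.flatMap_congr fun c hc => ?_
      rw [List.filter_filter]
      refine List.filter_congr fun w _ => ?_
      have := (he.1 c hc).ne'
      by_cases h : key w = c <;> simp [h, this]
    rw [List.flatMap_cons, h2, h1]
    refine filter_append_filter key b ws hs fun w hw => ?_
    rcases List.mem_cons.1 (hb w hw) with h | h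
    · exact h.ge
    · exact (he.1 _ h).le

lemma exists_famPairs_eq {d : ℕ} (ws : List (Fin d × Fin d))
    (hs : ws.Pairwise fun v w => v.2 ≤ w.2) : ∃ L, famPairs L = ws := by
  refine ⟨fun b => (ws.filter fun w => w.2 = b).map Prod.fst, ?_⟩
  conv_rhs => rw [← flatMap_filter_eq Prod.snd (List.finRange d) (List.pairwise_lt_finRange d) ws hs
    fun w _ => List.mem_finRange _]
  rw [famPairs]
  refine List.flatMap_congr fun b _ => ?_
  rw [List.map_map]
  conv_rhs => rw [← List.map_id (List.filter _ ws)]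
  refine List.map_congr_left fun w hw => ?_
  have : w.2 = b := by simpa using (List.mem_filter.1 hw).2
  simp [← this]

lemma pairwise_famPairs {d : ℕ} (L : Fin d → List (Fin d)) :
    (famPairs L).Pairwise fun v w => v.2 ≤ w.2 := by
  rw [famPairs, List.pairwise_flatMap]
  constructor
  · intro b _
    exact List.pairwise_map.2 (List.pairwise_of_forall fun _ _ => le_rfl)
  · refine (List.pairwise_lt_finRange d).imp fun {b c} h v hv w hw => ?_
    simp only [List.mem_map] at hv hw
    obtain ⟨_, _, rfl⟩ := hv
    obtain ⟨_, _, rfl⟩ := hw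
    exact h.le

lemma famProd_eq_swapsProd {d : ℕ} (L : Fin d → List (Fin d)) :
    famProd (List.finRange d) L = swapsProd (famPairs L) := by
  rw [famProd, swapsProd, famPairs, List.map_flatMap, List.flatMap, List.prod_flatten,
    List.map_map]
  simp [Function.comp_def, swapProd]

lemma famWt_keyWt {d : ℕ} (x : ℂ) (L : Fin d → List (Fin d)) [Decidable (∀ w ∈ famPairs L, w.1 < w.2)] :
    famWt (keyWt Fin.val x) L =
      if ∀ w ∈ famPairs L, w.1 < w.2 then x ^ (famPairs L).length else 0 := by
  have h : famWt (keyWt Fin.val x) L =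
      ((famPairs L).map fun w => keyWt Fin.val x w.1 w.2).prod := by
    rw [famWt, Fin.prod_univ_def, famPairs, List.map_flatMap, List.flatMap, List.prod_flatten,
      List.map_map]
    simp [Function.comp_def, listWt]
  rw [h]
  split_ifs with hv
  · rw [List.map_congr_left (g := fun _ => x) fun w hw => by
      rw [keyWt, if_pos (Fin.lt_def.1 (hv w hw))]]
    simp
  · push Not at hv
    obtain ⟨w, hw, hlt⟩ := hv
    refine List.prod_eq_zero (List.mem_map.2 ⟨w, hw, ?_⟩)
    rw [keyWt, if_neg (not_lt.2 (Fin.le_def.1 hlt))]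

lemma max_support_swap {d : ℕ} {a b : Fin d} (h : a < b) :
    (Equiv.swap a b).support.max = b := by
  rw [Equiv.Perm.support_swap h.ne]
  simp [Finset.max_insert, h.le]

lemma swap_injective_of_lt {d : ℕ} {v w : Fin d × Fin d} (hv : v.1 < v.2) (hw : w.1 < w.2)
    (h : Equiv.swap v.1 v.2 = Equiv.swap w.1 w.2) : v = w := by
  have h2 : v.2 = w.2 := by
    have := max_support_swap hv
    rw [h, max_support_swap hw] at this
    exact (WithBot.coe_injective this).symm
  refine Prod.ext ?_ h2
  have := congrArg (fun π : Equiv.Perm (Fin d) => π v.2) h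
  simpa [h2] using this

/-- Increasing families of words of total length `r` correspond to monotone `r`-tuples. -/
noncomputable def famEquivMonotone (d r : ℕ) :
    {L : Fin d → List (Fin d) // (∀ w ∈ famPairs L, w.1 < w.2) ∧ (famPairs L).length = r} ≃
      {τ : Fin r → Equiv.Perm (Fin d) // IsMonotoneTuple τ} :=
  Equiv.ofBijective
    (fun L => ⟨fun i => Equiv.swap ((famPairs L.1).get (i.cast L.2.2.symm)).1
        ((famPairs L.1).get (i.cast L.2.2.symm)).2, fun i =>
          ⟨_, _, (L.2.1 _ (List.get_mem _ _)).ne, rfl⟩, fun i j hij => by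
        simp only [max_support_swap (L.2.1 _ (List.get_mem _ _))]
        rcases hij.eq_or_lt with rfl | hlt
        · exact le_rfl
        · exact WithBot.coe_le_coe.2 (List.pairwise_iff_get.1 (pairwise_famPairs L.1) _ _ hlt)⟩) (by
    constructor
    · rintro ⟨L, hL, hr⟩ ⟨L', hL', hr'⟩ h
      refine Subtype.ext (famPairs_injective (List.ext_get (hr.trans hr'.symm) fun n h1 h2 => ?_))
      refine swap_injective_of_lt (hL _ (List.get_mem _ _)) (hL' _ (List.get_mem _ _)) ?_
      exact congrFun (congrArg Subtype.val h) ⟨n, hr ▸ h1⟩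
    · rintro ⟨τ, hτ⟩
      have : ∀ i, ∃ w : Fin d × Fin d, w.1 < w.2 ∧ τ i = Equiv.swap w.1 w.2 := by
        intro i
        obtain ⟨a, b, hab, h⟩ := hτ.1 i
        rcases lt_or_gt_of_ne hab with h' | h'
        · exact ⟨(a, b), h', h⟩
        · exact ⟨(b, a), h', by rw [h, Equiv.swap_comm]⟩
      choose w hw hτw using this
      obtain ⟨L, hL⟩ := exists_famPairs_eq (List.ofFn w) (by
        rw [List.pairwise_ofFn]
        intro i j hij
        have := hτ.2 hij.le
        simp only [hτw, max_support_swap (hw _)] at this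
        exact WithBot.coe_le_coe.1 this)
      refine ⟨⟨L, ?_, by simp [hL]⟩, Subtype.ext (funext fun i => ?_)⟩
      · simpa [hL, List.mem_ofFn] using hw
      · simp [hL, hτw])

lemma ofFn_famEquivMonotone {d r : ℕ}
    (L : {L : Fin d → List (Fin d) // (∀ w ∈ famPairs L, w.1 < w.2) ∧ (famPairs L).length = r}) :
    List.ofFn (famEquivMonotone d r L).1 =
      (famPairs L.1).map fun w => Equiv.swap w.1 w.2 := by
  obtain ⟨L, h, rfl⟩ := L
  refine List.ext_get (by simp) fun n h1 h2 => ?_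
  simp [famEquivMonotone]
  rfl

/-- The cycle type of a permutation of `Fin d` as a partition of `d`. -/
def permType {d : ℕ} (π : Equiv.Perm (Fin d)) : d.Partition :=
  ⟨π.partition.parts, π.partition.parts_pos, π.partition.parts_sum.trans (Fintype.card_fin d)⟩

lemma hasCycleType_iff {d : ℕ} (π : Equiv.Perm (Fin d)) (α : d.Partition) :
    HasCycleType π α ↔ permType π = α := (Nat.Partition.ext_iff (x := permType π) (y := α)).symm

/-- The permutation completing `D` to a factorization of the identity. -/
def complPerm {d : ℕ} (D : PermFam (Fin d)) : Equiv.Perm (Fin d) :=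
  (D.1 * famProd (List.finRange d) D.2)⁻¹

/-- The words of the family are increasing. -/
def Increasing {d : ℕ} (L : Fin d → List (Fin d)) : Prop := ∀ w ∈ famPairs L, w.1 < w.2

lemma permType_inv {d : ℕ} (π : Equiv.Perm (Fin d)) : permType π⁻¹ = permType π := by
  refine Nat.Partition.ext ?_
  simp [permType, Equiv.Perm.parts_partition]

lemma finrank_fixSpace_le_one {d : ℕ} (D : PermFam (Fin d)) (hD : Conn D) :
    Module.finrank (ZMod 2) (fixSpace D.1 (famPairs D.2)) ≤ 1 := by
  have : fixSpace D.1 (famPairs D.2) ≤ Submodule.span (ZMod 2) {fun _ => 1} := by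
    intro f hf
    have hr : ∀ x y, Reach D x y → f x = f y := by
      intro x y h
      induction h with
      | rel x y h =>
        rcases h with rfl | h
        · exact (hf.1 x).symm
        · exact hf.2 (x, y) (mem_famPairs.2 h)
      | refl => rfl
      | symm _ _ _ ih => exact ih.symm
      | trans _ _ _ _ _ ih₁ ih₂ => exact ih₁.trans ih₂
    rw [Submodule.mem_span_singleton]
    rcases isEmpty_or_nonempty (Fin d) with h | ⟨⟨s⟩⟩
    · exact ⟨0, funext fun x => h.elim x⟩
    · exact ⟨f s, funext fun x => by simp [hr s x (hD s x)]⟩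
  refine (Submodule.finrank_mono this).trans ?_
  simpa using finrank_span_le_card (R := ZMod 2) ({fun _ => 1} : Set (Fin d → ZMod 2))

lemma cycleCount_add_le {d : ℕ} (D : PermFam (Fin d)) (hD : Conn D) (hL : Increasing D.2) :
    (permType (complPerm D)).parts.card + (permType D.1).parts.card ≤
      (famPairs D.2).length + 2 := by
  have h1 := card_parts_add_le D.1 (famPairs D.2) fun w hw => (hL w hw).ne
  have h2 := finrank_fixSpace_le_one D hD
  rw [complPerm, permType_inv, famProd_eq_swapsProd]
  simp only [permType]
  omega

lemma conn_iff_generatesTransitively {d : ℕ} (D : PermFam (Fin d)) :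
    GeneratesTransitively ({complPerm D, D.1} ∪
      {g | g ∈ (famPairs D.2).map fun w => Equiv.swap w.1 w.2}) ↔ Conn D := by
  set S : Set (Equiv.Perm (Fin d)) := {complPerm D, D.1} ∪
      {g | g ∈ (famPairs D.2).map fun w => Equiv.swap w.1 w.2} with hS
  constructor
  · intro h
    let H : Subgroup (Equiv.Perm (Fin d)) :=
      { carrier := {g | ∀ x, Reach D x (g x)}
        one_mem' := fun x => Relation.EqvGen.refl x
        mul_mem' := fun {g g'} hg hg' x => Relation.EqvGen.trans _ _ _ (hg' x) (hg (g' x))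
        inv_mem' := fun {g} hg x => by
          have := hg (g⁻¹ x)
          rw [← Equiv.Perm.mul_apply, mul_inv_cancel, Equiv.Perm.one_apply] at this
          exact Relation.EqvGen.symm _ _ this }
    have hσ : D.1 ∈ H := fun x => Relation.EqvGen.rel _ _ (Or.inl rfl)
    have hw : ∀ g ∈ (famPairs D.2).map fun w => Equiv.swap w.1 w.2, g ∈ H := by
      intro g hg x
      obtain ⟨w, hw, rfl⟩ := List.mem_map.1 hg
      have hr : Reach D w.1 w.2 := Relation.EqvGen.rel _ _ (Or.inr (mem_famPairs.1 hw))
      rcases eq_or_ne x w.1 with rfl | h1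
      · simpa using hr
      rcases eq_or_ne x w.2 with rfl | h2
      · rw [Equiv.swap_apply_right]
        exact Relation.EqvGen.symm _ _ hr
      · rw [Equiv.swap_apply_of_ne_of_ne h1 h2]
        exact Relation.EqvGen.refl x
    have hle : Subgroup.closure S ≤ H := by
      rw [Subgroup.closure_le]
      rintro g ((rfl | rfl) | hg)
      · refine H.inv_mem (H.mul_mem hσ ?_)
        rw [famProd_eq_swapsProd]
        exact H.list_prod_mem hw
      · exact hσ
      · exact hw g hg
    intro x y
    obtain ⟨g, hg, rfl⟩ := h x y
    exact hle hg x
  · intro h x y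
    have hr := h x y
    induction hr with
    | rel x y h =>
      rcases h with rfl | h
      · exact ⟨D.1, Subgroup.subset_closure (by simp [hS]), rfl⟩
      · refine ⟨Equiv.swap x y, Subgroup.subset_closure (Or.inr ?_), by simp⟩
        exact List.mem_map.2 ⟨(x, y), mem_famPairs.2 h, rfl⟩
    | refl => exact ⟨1, Subgroup.one_mem _, rfl⟩
    | symm _ _ _ ih =>
      obtain ⟨g, hg, rfl⟩ := ih
      exact ⟨g⁻¹, Subgroup.inv_mem _ hg, by simp⟩
    | trans _ _ _ _ _ ih₁ ih₂ =>
      obtain ⟨g, hg, rfl⟩ := ih₁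
      obtain ⟨g', hg', rfl⟩ := ih₂
      exact ⟨g' * g, Subgroup.mul_mem _ hg' hg, rfl⟩

lemma natCard_eq_Hr {d : ℕ} (α β : d.Partition) (r : ℕ) :
    Nat.card {D : PermFam (Fin d) // (Conn D ∧ Increasing D.2 ∧ (famPairs D.2).length = r) ∧
      permType (complPerm D) = α ∧ permType D.1 = β} = Hr d α β r := by
  have hrange : ∀ L, Set.range (famEquivMonotone d r L).1 =
      {g | g ∈ (famPairs L.1).map fun w => Equiv.swap w.1 w.2} := fun L => by
    rw [← ofFn_famEquivMonotone]
    ext g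
    simp [List.mem_ofFn]
  have hprod : ∀ L, (List.ofFn (famEquivMonotone d r L).1).prod =
      famProd (List.finRange d) L.1 := fun L => by
    rw [ofFn_famEquivMonotone, famProd_eq_swapsProd]; rfl
  refine Nat.card_eq_of_bijective (fun D => ⟨(complPerm D.1, D.1.1,
    (famEquivMonotone d r ⟨D.1.2, D.2.1.2⟩).1), (hasCycleType_iff _ _).2 D.2.2.1,
    (hasCycleType_iff _ _).2 D.2.2.2, (famEquivMonotone d r ⟨D.1.2, D.2.1.2⟩).2, ?_, ?_⟩) ⟨?_, ?_⟩
  · rw [hprod, mul_assoc]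
    exact inv_mul_cancel _
  · rw [hrange]
    exact (conn_iff_generatesTransitively D.1).2 D.2.1.1
  · rintro ⟨⟨σ, L⟩, h⟩ ⟨⟨σ', L'⟩, h'⟩ heq
    simp only [Subtype.mk.injEq, Prod.mk.injEq] at heq
    obtain ⟨_, rfl, h3⟩ := heq
    have := congrArg Subtype.val ((famEquivMonotone d r).injective (Subtype.ext h3))
    simp only at this
    subst this
    rfl
  · rintro ⟨⟨ρ, σ, τ⟩, h1, h2, h3, h4, h5⟩
    obtain ⟨L, hL⟩ := (famEquivMonotone d r).surjective ⟨τ, h3⟩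
    simp only at h1 h2 h3 h4 h5
    have hτ : τ = (famEquivMonotone d r L).1 := by rw [hL]
    have hρ : complPerm (σ, L.1) = ρ := by
      rw [complPerm, ← hprod, ← hτ, inv_eq_iff_mul_eq_one.2]
      rw [mul_assoc] at h4
      rw [mul_eq_one_iff_eq_inv.1 h4]
      simp
    refine ⟨⟨(σ, L.1), ⟨?_, L.2⟩, ?_, ?_⟩, Subtype.ext ?_⟩
    · rw [← conn_iff_generatesTransitively, hρ, ← hrange, ← hτ]
      exact h5
    · rw [hρ]; exact (hasCycleType_iff _ _).1 h1
    · exact (hasCycleType_iff _ _).1 h2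
    · simp [hρ, hL]

/-- Transitive increasing data of minimal length. -/
def GenusZero {d : ℕ} (D : PermFam (Fin d)) : Prop :=
  Conn D ∧ Increasing D.2 ∧ (famPairs D.2).length + 2 =
    (permType (complPerm D)).parts.card + (permType D.1).parts.card

lemma card_parts_le {d : ℕ} (α : d.Partition) : α.parts.card ≤ d := by
  have := Multiset.card_nsmul_le_sum (s := α.parts) (a := 1) fun x hx => α.parts_pos hx
  rwa [α.parts_sum, smul_eq_mul, mul_one] at this

lemma one_le_card_parts {d : ℕ} (hd : 1 ≤ d) (α : d.Partition) : 1 ≤ α.parts.card := by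
  rw [Nat.one_le_iff_ne_zero, Ne, Multiset.card_eq_zero]
  intro h
  have := α.parts_sum
  rw [h] at this
  simp at this
  omega

lemma finite_genusZero (d : ℕ) : {D : PermFam (Fin d) | GenusZero D}.Finite := by
  have h1 : {L : Fin d → List (Fin d) | (famPairs L).length ≤ 2 * d}.Finite :=
    (List.finite_length_le (Fin d × Fin d) (2 * d)).preimage famPairs_injective.injOn
  refine (Set.Finite.prod Set.finite_univ h1).subset fun D hD => ⟨Set.mem_univ _, ?_⟩
  have h2 := card_parts_le (permType (complPerm D))
  have h3 := card_parts_le (permType D.1)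
  have := hD.2.2
  simp only [Set.mem_ofPred_eq]
  omega

open Classical in
lemma tsum_genusZero {d : ℕ} (hd : 1 ≤ d) (Φ Ψ : ℕ → ℂ) :
    ∑' D : PermFam (Fin d), (if GenusZero D then (-1) ^ (famPairs D.2).length *
      (momProd Φ (permType (complPerm D)) * momProd Ψ (permType D.1)) else 0) =
      (-1) ^ d * Cseq 0 d Φ Ψ := by
  set s := (finite_genusZero d).toFinset with hs
  have hmem : ∀ D, D ∈ s ↔ GenusZero D := fun D => by simp [hs]
  rw [tsum_eq_sum (s := s) fun D hD => if_neg fun h => hD ((hmem D).2 h),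
    ← Finset.sum_fiberwise s fun D => (permType (complPerm D), permType D.1),
    Fintype.sum_prod_type, Cseq, Finset.mul_sum]
  refine Finset.sum_congr rfl fun α _ => ?_
  rw [Finset.mul_sum]
  refine Finset.sum_congr rfl fun β _ => ?_
  have hα := one_le_card_parts hd α
  have hβ := one_le_card_parts hd β
  have hcard : (s.filter fun D => (permType (complPerm D), permType D.1) = (α, β)).card =
      Hg d 0 α β := by
    rw [Hg, ← natCard_eq_Hr, ← Nat.card_eq_finsetCard]
    refine Nat.card_congr (Equiv.subtypeEquivRight fun D => ?_)
    simp only [Finset.mem_filter, hmem, GenusZero, Prod.mk.injEq]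
    constructor
    · rintro ⟨⟨h1, h2, h3⟩, rfl, rfl⟩
      exact ⟨⟨h1, h2, by omega⟩, rfl, rfl⟩
    · rintro ⟨⟨h1, h2, h3⟩, rfl, rfl⟩
      exact ⟨⟨h1, h2, by omega⟩, rfl, rfl⟩
  have hsum : ∀ D ∈ s.filter fun D => (permType (complPerm D), permType D.1) = (α, β),
      (if GenusZero D then (-1) ^ (famPairs D.2).length *
        (momProd Φ (permType (complPerm D)) * momProd Ψ (permType D.1)) else 0) =
      (-1 : ℂ) ^ (α.parts.card + β.parts.card) * (momProd Φ α * momProd Ψ β) := by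
    intro D hD
    simp only [Finset.mem_filter, hmem, Prod.mk.injEq] at hD
    obtain ⟨h, rfl, rfl⟩ := hD
    rw [if_pos h, ← h.2.2, pow_add]
    simp
  rw [Finset.sum_congr rfl hsum, Finset.sum_const, hcard, nsmul_eq_mul, add_assoc, pow_add _ d]
  have : ((-1 : ℂ) ^ d) * (-1) ^ d = 1 := by rw [← mul_pow]; simp
  linear_combination (-(Hg d 0 α β : ℂ) * (-1) ^ (α.parts.card + β.parts.card) *
    momProd Φ α * momProd Ψ β) * this

/-- The normalized moments of a matrix. -/
noncomputable def normMom {N : ℕ} (A : Matrix (Fin N) (Fin N) ℂ) (k : ℕ) : ℂ :=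
  (N : ℂ)⁻¹ * (A ^ k).trace

lemma permTr_eq_momProd {d N : ℕ} (hN : 0 < N) (A : Matrix (Fin N) (Fin N) ℂ)
    (π : Equiv.Perm (Fin d)) :
    permTr A π = N ^ (permType π).parts.card * momProd (normMom A) (permType π) := by
  have hN' : (N : ℂ) ≠ 0 := by exact_mod_cast hN.ne'
  rw [permTr_eq_prod, momProd]
  unfold normMom
  rw [Multiset.prod_map_mul, Multiset.map_const', Multiset.prod_replicate, ← mul_assoc, ← mul_pow,
    mul_inv_cancel₀ hN', one_pow, one_mul]
  rfl

open Classical in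
/-- A transitive summand, rescaled by `N ^ 2`. -/
noncomputable def scaledTerm {d N : ℕ} (A B : Matrix (Fin N) (Fin N) ℂ) (D : PermFam (Fin d)) : ℂ :=
  if Conn D ∧ Increasing D.2 then (-1) ^ (famPairs D.2).length *
    ((N : ℂ)⁻¹ ^ ((famPairs D.2).length + 2 - ((permType (complPerm D)).parts.card +
      (permType D.1).parts.card)) *
    (momProd (normMom A) (permType (complPerm D)) * momProd (normMom B) (permType D.1))) else 0

lemma connSum_eq_tsum_scaledTerm {d N : ℕ} (hN : 0 < N) (A B : Matrix (Fin N) (Fin N) ℂ) :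
    connSum A B Fin.val (List.finRange d) =
      (N : ℂ) ^ 2 * ∑' D : PermFam (Fin d), scaledTerm A B D := by
  have hN' : (N : ℂ) ≠ 0 := by exact_mod_cast hN.ne'
  rw [connSum, ← tsum_mul_left]
  refine tsum_congr fun D => ?_
  by_cases hc : Conn D
  · by_cases hi : Increasing D.2
    · rw [if_pos hc, scaledTerm, if_pos ⟨hc, hi⟩, pairWt, famWt_keyWt,
        if_pos (show ∀ w ∈ famPairs D.2, w.1 < w.2 from hi),
        permTr_eq_momProd hN, permTr_eq_momProd hN]
      change _ * (_ ^ (permType (complPerm D)).parts.card *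
        momProd (normMom A) (permType (complPerm D)) * _) = _
      have hle := cycleCount_add_le D hc hi
      obtain ⟨j, hj⟩ := Nat.exists_eq_add_of_le hle
      rw [hj, Nat.add_sub_cancel_left]
      have hpow : (N : ℂ)⁻¹ ^ (famPairs D.2).length * (N : ℂ) ^ ((permType (complPerm D)).parts.card +
          (permType D.1).parts.card) = (N : ℂ) ^ 2 * (N : ℂ)⁻¹ ^ j := by
        have h1 : (N : ℂ) ^ ((famPairs D.2).length + 2) = (N : ℂ) ^
          ((permType (complPerm D)).parts.card + (permType D.1).parts.card + j) := by rw [hj]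
        rw [pow_add, pow_add _ _ j] at h1
        rw [inv_pow, inv_pow]
        field_simp
        linear_combination -h1
      rw [neg_pow]
      rw [pow_add] at hpow
      linear_combination ((-1) ^ (famPairs D.2).length *
        momProd (normMom A) (permType (complPerm D)) *
        momProd (normMom B) (permType D.1)) * hpow
    · rw [if_pos hc, scaledTerm, if_neg fun h => hi h.2, pairWt, famWt_keyWt,
        if_neg (show ¬∀ w ∈ famPairs D.2, w.1 < w.2 from hi)]
      simp
  · rw [if_neg hc, scaledTerm, if_neg fun h => hc h.1, mul_zero]

lemma tendsto_momProd {d : ℕ} {φ : ℕ → ℕ → ℂ} {Φ : ℕ → ℂ}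
    (h : ∀ k, 1 ≤ k → Filter.Tendsto (fun N => φ N k) Filter.atTop (nhds (Φ k)))
    (α : d.Partition) :
    Filter.Tendsto (fun N => momProd (φ N) α) Filter.atTop (nhds (momProd Φ α)) :=
  tendsto_multiset_prod _ fun k hk => h k (α.parts_pos hk)

lemma tendsto_scaledTerm {d : ℕ} {A B : ∀ N : ℕ, Matrix (Fin N) (Fin N) ℂ} {Φ Ψ : ℕ → ℂ}
    (hA : ∀ k, 1 ≤ k → Filter.Tendsto (fun N => normMom (A N) k) Filter.atTop (nhds (Φ k)))
    (hB : ∀ k, 1 ≤ k → Filter.Tendsto (fun N => normMom (B N) k) Filter.atTop (nhds (Ψ k)))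
    (D : PermFam (Fin d)) [Decidable (GenusZero D)] :
    Filter.Tendsto (fun N => scaledTerm (A N) (B N) D) Filter.atTop
      (nhds (if GenusZero D then (-1) ^ (famPairs D.2).length *
        (momProd Φ (permType (complPerm D)) * momProd Ψ (permType D.1)) else 0)) := by
  by_cases hc : Conn D ∧ Increasing D.2
  · simp only [scaledTerm, if_pos hc]
    have hle := cycleCount_add_le D hc.1 hc.2
    obtain ⟨j, hj⟩ := Nat.exists_eq_add_of_le hle
    rw [hj, Nat.add_sub_cancel_left]
    have hinv : Filter.Tendsto (fun N : ℕ => (N : ℂ)⁻¹) Filter.atTop (nhds 0) :=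
      tendsto_inv_atTop_nhds_zero_nat
    have := ((hinv.pow j).mul ((tendsto_momProd hA (permType (complPerm D))).mul
      (tendsto_momProd hB (permType D.1)))).const_mul ((-1 : ℂ) ^ (famPairs D.2).length)
    convert this using 2
    by_cases hj0 : j = 0
    · rw [if_pos ⟨hc.1, hc.2, by omega⟩, hj0]
      simp
    · rw [if_neg fun h => hj0 (by have := h.2.2; omega), zero_pow hj0]
      simp
  · simp only [scaledTerm, if_neg hc]
    rw [if_neg fun h => hc ⟨h.1, h.2.1⟩]
    exact tendsto_const_nhds

lemma eventually_norm_momProd_le {d : ℕ} {φ : ℕ → ℕ → ℂ} {Φ : ℕ → ℂ}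
    (h : ∀ k, 1 ≤ k → Filter.Tendsto (fun N => φ N k) Filter.atTop (nhds (Φ k))) :
    ∃ C : ℝ, 0 ≤ C ∧ ∀ᶠ N in Filter.atTop, ∀ α : d.Partition, ‖momProd (φ N) α‖ ≤ C := by
  refine ⟨∑ α : d.Partition, (‖momProd Φ α‖ + 1), by positivity, ?_⟩
  rw [Filter.eventually_all]
  intro α
  filter_upwards [(tendsto_momProd h α).norm.eventually_le_const (lt_add_one _)] with N hN
  exact hN.trans (Finset.single_le_sum (f := fun α : d.Partition => ‖momProd Φ α‖ + 1)
    (fun _ _ => by positivity) (Finset.mem_univ α))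

lemma summable_norm_keyFamWt (d : ℕ) : Summable fun D : PermFam (Fin d) =>
    ‖famWt (keyWt Fin.val ((d + 1 : ℕ) : ℂ)⁻¹) D.2‖ := by
  have h1 := summable_norm_famWt (keyWt Fin.val ((d + 1 : ℕ) : ℂ)⁻¹)
    (sum_norm_keyWt_lt (α := Fin d) Fin.val _ (by
      rw [norm_inv, Complex.norm_natCast, ← div_eq_mul_inv, Fintype.card_fin]
      exact div_le_one_of_le₀ (by exact_mod_cast d.le_succ) (Nat.cast_nonneg _)))
  exact (summable_prod_of_nonneg fun _ => norm_nonneg _).mpr ⟨fun _ => h1, Summable.of_finite⟩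

/-- The rescaled transitive sums converge to the genus zero coefficients. -/
theorem tendsto_tsum_scaledTerm {d : ℕ} (hd : 1 ≤ d)
    {A B : ∀ N : ℕ, Matrix (Fin N) (Fin N) ℂ} {Φ Ψ : ℕ → ℂ}
    (hA : ∀ k, 1 ≤ k → Filter.Tendsto (fun N => normMom (A N) k) Filter.atTop (nhds (Φ k)))
    (hB : ∀ k, 1 ≤ k → Filter.Tendsto (fun N => normMom (B N) k) Filter.atTop (nhds (Ψ k))) :
    Filter.Tendsto (fun N => ∑' D : PermFam (Fin d), scaledTerm (A N) (B N) D) Filter.atTop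
      (nhds ((-1) ^ d * Cseq 0 d Φ Ψ)) := by
  classical
  obtain ⟨C₁, hC₁, h₁⟩ := eventually_norm_momProd_le (d := d) hA
  obtain ⟨C₂, hC₂, h₂⟩ := eventually_norm_momProd_le (d := d) hB
  rw [← tsum_genusZero hd]
  refine tendsto_tsum_of_dominated_convergence
    ((summable_norm_keyFamWt d).mul_left (((d + 1 : ℕ) : ℝ) ^ (2 * d) * (C₁ * C₂)))
    (fun D => tendsto_scaledTerm hA hB D) ?_
  filter_upwards [h₁, h₂, Filter.eventually_ge_atTop (d + 1)] with N hN₁ hN₂ hN D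
  by_cases hc : Conn D ∧ Increasing D.2
  · rw [scaledTerm, if_pos hc, famWt_keyWt,
      if_pos (show ∀ w ∈ famPairs D.2, w.1 < w.2 from hc.2)]
    have hle := cycleCount_add_le D hc.1 hc.2
    have hα := card_parts_le (permType (complPerm D))
    have hβ := card_parts_le (permType D.1)
    set m := (famPairs D.2).length
    set l := (permType (complPerm D)).parts.card + (permType D.1).parts.card with hl
    have hd1 : (1 : ℝ) ≤ ((d + 1 : ℕ) : ℝ) := by exact_mod_cast Nat.le_add_left 1 d
    have hpow : ((N : ℝ)⁻¹) ^ (m + 2 - l) ≤ ((d + 1 : ℕ) : ℝ) ^ (2 * d) * ((d + 1 : ℕ) : ℝ)⁻¹ ^ m := by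
      calc ((N : ℝ)⁻¹) ^ (m + 2 - l) ≤ (((d + 1 : ℕ) : ℝ)⁻¹) ^ (m + 2 - l) := by
            gcongr
        _ ≤ ((d + 1 : ℕ) : ℝ) ^ (2 * d) * ((d + 1 : ℕ) : ℝ)⁻¹ ^ m := by
            rw [inv_pow, inv_pow, ← div_eq_mul_inv, le_div_iff₀ (by positivity), mul_comm,
              ← div_eq_mul_inv, div_le_iff₀ (by positivity), ← pow_add]
            exact pow_le_pow_right₀ hd1 (by omega)
    rw [norm_mul, norm_mul, norm_mul, norm_pow, norm_neg, norm_one, one_pow, one_mul, norm_pow,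
      norm_inv, Complex.norm_natCast, norm_pow, norm_inv, Complex.norm_natCast]
    calc _ ≤ (((d + 1 : ℕ) : ℝ) ^ (2 * d) * ((d + 1 : ℕ) : ℝ)⁻¹ ^ m) * (C₁ * C₂) := by
          gcongr
          · exact hN₁ _
          · exact hN₂ _
      _ = _ := by ring
  · rw [scaledTerm, if_neg hc, norm_zero]
    positivity

lemma norm_trace_le {N : ℕ} (X : Matrix (Fin N) (Fin N) ℂ) : ‖X.trace‖ ≤ N * opNorm X := by
  have h : ∀ i, ‖X i i‖ ≤ opNorm X := by
    intro i
    have h1 := (Matrix.toEuclideanCLM (𝕜 := ℂ) X).le_opNorm (EuclideanSpace.single i 1)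
    rw [PiLp.norm_single, norm_one, mul_one] at h1
    have h2 := PiLp.norm_apply_le (Matrix.toEuclideanCLM (𝕜 := ℂ) X (EuclideanSpace.single i 1)) i
    have h3 : (Matrix.toEuclideanCLM (𝕜 := ℂ) X (EuclideanSpace.single i 1)) i = X i i := by
      rw [Matrix.ofLp_toEuclideanCLM]
      simp
    rw [h3] at h2
    exact h2.trans h1
  rw [Matrix.trace]
  refine (norm_sum_le_of_le _ fun i _ => h i).trans ?_
  simp

lemma opNorm_mul_conjMat_le {N : ℕ} (A B : Matrix (Fin N) (Fin N) ℂ)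
    (U : Matrix.unitaryGroup (Fin N) ℂ) : opNorm (A * conjMat B U) ≤ opNorm A * opNorm B := by
  have hU : ∀ V : Matrix.unitaryGroup (Fin N) ℂ, Matrix.toEuclideanCLM (𝕜 := ℂ) V.1 ∈
      unitary (EuclideanSpace ℂ (Fin N) →L[ℂ] EuclideanSpace ℂ (Fin N)) := fun V =>
    Unitary.map_mem (Matrix.toEuclideanCLM (𝕜 := ℂ) (n := Fin N)) V.2
  unfold opNorm conjMat
  rw [map_mul, map_mul, map_mul]
  refine (norm_mul_le _ _).trans ?_
  rw [CStarRing.norm_mul_mem_unitary _ (hU _), CStarRing.norm_mem_unitary_mul _ (hU _)]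

lemma norm_hciz_le {N : ℕ} (μ : Measure (Matrix.unitaryGroup (Fin N) ℂ)) [IsProbabilityMeasure μ]
    (A B : Matrix (Fin N) (Fin N) ℂ) (M : ℝ) (hM : 0 ≤ M) (hA : opNorm A ≤ M) (hB : opNorm B ≤ M)
    (z : ℂ) : ‖hciz μ A B z‖ ≤ Real.exp ((N : ℝ) ^ 2 * (‖z‖ * M ^ 2)) := by
  rw [hciz_eq]
  refine (norm_integral_le_of_norm_le_const (C := Real.exp ((N : ℝ) ^ 2 * (‖z‖ * M ^ 2)))
    (Filter.Eventually.of_forall fun U => ?_)).trans (by simp)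
  rw [Complex.norm_exp]
  refine Real.exp_le_exp.2 ((Complex.re_le_norm _).trans ?_)
  have h1 : ‖(A * conjMat B U).trace‖ ≤ N * (M * M) :=
    (norm_trace_le _).trans (mul_le_mul_of_nonneg_left ((opNorm_mul_conjMat_le A B U).trans
      (mul_le_mul hA hB (norm_nonneg _) hM)) (Nat.cast_nonneg _))
  rw [norm_mul, norm_mul, norm_neg, Complex.norm_natCast]
  calc _ ≤ ‖z‖ * (N * (N * (M * M))) := by gcongr
    _ = _ := by ring

lemma re_freeEnergy_le {N : ℕ} (hN : 0 < N) (μ : Measure (Matrix.unitaryGroup (Fin N) ℂ))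
    [IsProbabilityMeasure μ] (A B : Matrix (Fin N) (Fin N) ℂ) (M : ℝ) (hM : 0 ≤ M)
    (hA : opNorm A ≤ M) (hB : opNorm B ≤ M) (r : ℝ) (F : ℂ → ℂ)
    (hF : IsFreeEnergyBranch μ A B r F) (z : ℂ) (hz : z ∈ Metric.ball 0 r) :
    (F z).re ≤ ‖z‖ * M ^ 2 := by
  have h := norm_hciz_le μ A B M hM hA hB z
  rw [← hF.2.2 z hz, Complex.norm_exp, Real.exp_le_exp] at h
  have h2 : ((N : ℂ) ^ 2 * F z).re = (N : ℝ) ^ 2 * (F z).re := by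
    rw [← Complex.re_ofReal_mul]; norm_cast
  rw [h2] at h
  exact le_of_mul_le_mul_left h (by positivity)

/-- The Taylor coefficients of the free energies converge to the genus zero coefficients. -/
theorem tendsto_iteratedDeriv_freeEnergy {A B : ∀ N : ℕ, Matrix (Fin N) (Fin N) ℂ} {Φ Ψ : ℕ → ℂ}
    (hA : ∀ k, 1 ≤ k → Filter.Tendsto (fun N => normMom (A N) k) Filter.atTop (nhds (Φ k)))
    (hB : ∀ k, 1 ≤ k → Filter.Tendsto (fun N => normMom (B N) k) Filter.atTop (nhds (Ψ k)))
    (μ : ∀ N : ℕ, Measure (Matrix.unitaryGroup (Fin N) ℂ))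
    [∀ N, (μ N).IsMulLeftInvariant] [∀ N, IsProbabilityMeasure (μ N)]
    (r : ℝ) (hr : 0 < r) (F : ℕ → ℂ → ℂ)
    (hF : ∀ N : ℕ, 1 ≤ N → IsFreeEnergyBranch (μ N) (A N) (B N) r (F N)) (n : ℕ) :
    Filter.Tendsto (fun N => iteratedDeriv (n + 1) (F N) 0) Filter.atTop
      (nhds (Cseq 0 (n + 1) Φ Ψ)) := by
  have h := (tendsto_tsum_scaledTerm (d := n + 1) (by omega) hA hB).const_mul ((-1 : ℂ) ^ (n + 1))
  have h1 : ((-1 : ℂ) ^ (n + 1)) * (-1) ^ (n + 1) = 1 := by rw [← mul_pow]; simp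
  rw [← mul_assoc, h1, one_mul] at h
  refine h.congr' ?_
  filter_upwards [Filter.eventually_ge_atTop (n + 1)] with N hN
  have hN0 : 0 < N := by omega
  have hN' : (N : ℂ) ^ 2 ≠ 0 := pow_ne_zero _ (by exact_mod_cast hN0.ne')
  have h2 := connSum_eq_iteratedDeriv hN0 (μ N) (A N) (B N) r hr (F N) (hF N hN0) n (Fin (n + 1))
    Fin.val (List.finRange (n + 1)) ((List.pairwise_lt_finRange _).imp fun h => Fin.lt_def.1 h)
    List.mem_finRange (Fintype.card_fin _) (by rwa [Fintype.card_fin])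
  rw [connSum_eq_tsum_scaledTerm hN0] at h2
  refine mul_left_cancel₀ hN' ?_
  linear_combination (-1 : ℂ) ^ (n + 1) * h2 + (N : ℂ) ^ 2 * iteratedDeriv (n + 1) (F N) 0 * h1

/-- Holomorphic functions vanishing at the origin whose real parts are bounded above and whose
Taylor coefficients converge do converge uniformly on compact subsets. -/
theorem tendstoUniformlyOn_of_tendsto_coeff {r m : ℝ} (hr : 0 < r) (hm : 0 < m) (F : ℕ → ℂ → ℂ)
    (hd : ∀ᶠ N in Filter.atTop, DifferentiableOn ℂ (F N) (Metric.ball 0 r) ∧ F N 0 = 0 ∧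
      ∀ z ∈ Metric.ball (0 : ℂ) r, (F N z).re ≤ m) (c : ℕ → ℂ)
    (hc : ∀ n, Filter.Tendsto (fun N => iteratedDeriv (n + 1) (F N) 0) Filter.atTop (nhds (c n)))
    (K : Set ℂ) (hK : K ⊆ Metric.ball 0 r) (hKc : IsCompact K) :
    TendstoUniformlyOn F (fun z => ∑' n : ℕ, c n * z ^ (n + 1) / ((n + 1).factorial : ℂ))
      Filter.atTop K := by
  obtain ⟨s, ⟨hs0, hsr⟩, hKs⟩ := exists_pos_lt_subset_ball hr hKc.isClosed hK
  obtain ⟨t, hst, htr⟩ := exists_between hsr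
  have ht0 : 0 < t := hs0.trans hst
  set C : ℝ := 2 * m * t / (r - t) with hC
  have hC0 : 0 ≤ C := div_nonneg (by positivity) (by linarith)
  have hfac : ∀ n : ℕ, (0 : ℝ) < (n + 1).factorial := fun n => by positivity
  have hbd : ∀ᶠ N in Filter.atTop, ∀ n,
      ‖iteratedDeriv (n + 1) (F N) 0‖ ≤ (n + 1).factorial * C / t ^ (n + 1) := by
    filter_upwards [hd] with N ⟨h1, h2, h3⟩ n
    refine Complex.norm_iteratedDeriv_le_of_forall_mem_sphere_norm_le (n + 1) ht0
      (DifferentiableOn.diffContOnCl (h1.mono ?_)) fun z hz => ?_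
    · rw [closure_ball _ ht0.ne']
      exact Metric.closedBall_subset_ball htr
    · have hz' : ‖z‖ = t := by simpa using hz
      have := Complex.borelCaratheodory_zero hm h1 h3 hr
        (z := z) (by simpa [hz'] using htr) h2
      rwa [hz'] at this
  have hcb : ∀ n, ‖c n‖ ≤ (n + 1).factorial * C / t ^ (n + 1) := fun n =>
    le_of_tendsto (hc n).norm (hbd.mono fun N h => h n)
  have hgeom : Summable fun n : ℕ => C * (s / t) ^ (n + 1) := by
    have := summable_geometric_of_lt_one (div_nonneg hs0.le ht0.le) ((div_lt_one ht0).2 hst)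
    exact ((summable_nat_add_iff 1).2 this).mul_left C
  have hterm : ∀ (n : ℕ) (x z : ℂ), ‖x‖ ≤ (n + 1).factorial * C / t ^ (n + 1) → ‖z‖ ≤ s →
      ‖x * z ^ (n + 1) / ((n + 1).factorial : ℂ)‖ ≤ C * (s / t) ^ (n + 1) := by
    intro n x z hx hz
    rw [norm_div, norm_mul, norm_pow, Complex.norm_natCast]
    calc _ ≤ (n + 1).factorial * C / t ^ (n + 1) * s ^ (n + 1) / (n + 1).factorial := by gcongr
      _ = _ := by
        have := (hfac n).ne'
        rw [div_pow]
        field_simp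
  have hsn : ‖(s : ℂ)‖ = s := by simp [abs_of_pos hs0]
  have hdom : Filter.Tendsto (fun N => ∑' n : ℕ,
      ‖(iteratedDeriv (n + 1) (F N) 0 - c n) * (s : ℂ) ^ (n + 1) / ((n + 1).factorial : ℂ)‖)
      Filter.atTop (nhds 0) := by
    have : (0 : ℝ) = ∑' _ : ℕ, (0 : ℝ) := by simp
    rw [this]
    refine tendsto_tsum_of_dominated_convergence (hgeom.mul_left 2) (fun n => ?_) ?_
    · have h1 := (((hc n).sub_const (c n)).mul_const ((s : ℂ) ^ (n + 1))).div_const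
        ((n + 1).factorial : ℂ)
      simpa using h1.norm
    · filter_upwards [hbd] with N h n
      rw [norm_norm, sub_mul, sub_div]
      refine (norm_sub_le _ _).trans ?_
      have h1 := hterm n _ s (h n) hsn.le
      have h2 := hterm n _ s (hcb n) hsn.le
      linarith
  rw [Metric.tendstoUniformlyOn_iff]
  intro ε hε
  filter_upwards [hd, hbd, hdom.eventually_lt_const hε] with N ⟨h1, h2, h3⟩ hb hlt z hz
  have hzs : ‖z‖ ≤ s := (mem_ball_zero_iff.1 (hKs hz)).le
  have hzr : z ∈ Metric.ball 0 r := hK hz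
  have hF : HasSum (fun n : ℕ =>
      iteratedDeriv (n + 1) (F N) 0 * z ^ (n + 1) / ((n + 1).factorial : ℂ)) (F N z) := by
    have h4 := Complex.hasSum_taylorSeries_on_ball h1 hzr
    rw [← hasSum_nat_add_iff' 1] at h4
    simp only [Finset.sum_range_one, iteratedDeriv_zero, h2, smul_zero, sub_zero] at h4
    refine h4.congr_fun fun n => ?_
    simp only [smul_eq_mul]
    ring
  have hcs : Summable fun n : ℕ => c n * z ^ (n + 1) / ((n + 1).factorial : ℂ) :=
    Summable.of_norm_bounded hgeom fun n => hterm n _ z (hcb n) hzs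
  rw [dist_comm, dist_eq_norm, ← hF.tsum_eq, ← hF.summable.tsum_sub hcs]
  have hsumm : Summable fun n : ℕ => ‖(iteratedDeriv (n + 1) (F N) 0 - c n) * (s : ℂ) ^ (n + 1) /
      ((n + 1).factorial : ℂ)‖ := by
    refine Summable.of_nonneg_of_le (fun _ => norm_nonneg _) (fun n => ?_) (hgeom.mul_left 2)
    rw [sub_mul, sub_div]
    refine (norm_sub_le _ _).trans ?_
    have h1 := hterm n _ s (hb n) hsn.le
    have h2 := hterm n _ s (hcb n) hsn.le
    linarith
  refine lt_of_le_of_lt (tsum_of_norm_bounded hsumm.hasSum fun n => ?_) hlt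
  rw [← sub_div, ← sub_mul, norm_div, norm_div, norm_mul, norm_mul, norm_pow, norm_pow, hsn]
  gcongr

/-- Under the HCIZ non-vanishing hypothesis, the free energy `F_N` converges to
`C_0(z;Φ,Ψ)` uniformly on compact subsets of `D(0,r)`, `r = min(R, (2/27)M⁻²)`. -/
theorem free_energy_tendsto_uniformly_on_compacts (M : ℝ) (hM : 0 < M) (Φ Ψ : ℕ → ℂ)
    (A B : ∀ N : ℕ, Matrix (Fin N) (Fin N) ℂ)
    (hAnormal : ∀ N, IsStarNormal (A N)) (hBnormal : ∀ N, IsStarNormal (B N))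
    (hAbd : ∀ N, opNorm (A N) ≤ M) (hBbd : ∀ N, opNorm (B N) ≤ M)
    (hAmom : ∀ k : ℕ, 1 ≤ k → Filter.Tendsto
      (fun N : ℕ => (N : ℂ)⁻¹ * ((A N) ^ k).trace) Filter.atTop (nhds (Φ k)))
    (hBmom : ∀ k : ℕ, 1 ≤ k → Filter.Tendsto
      (fun N : ℕ => (N : ℂ)⁻¹ * ((B N) ^ k).trace) Filter.atTop (nhds (Ψ k)))
    (μ : ∀ N : ℕ, Measure (Matrix.unitaryGroup (Fin N) ℂ))
    (hμ : ∀ N, (μ N).IsHaarMeasure) (hμprob : ∀ N, IsProbabilityMeasure (μ N))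
    (R : ℝ) (hR : 0 < R)
    (hnz : ∀ N : ℕ, 1 ≤ N → ∀ z : ℂ, ‖z‖ < R → hciz (μ N) (A N) (B N) z ≠ 0)
    (r : ℝ) (hr : r = min R (2 / 27 * (M ^ 2)⁻¹))
    (F : ℕ → ℂ → ℂ)
    (hF : ∀ N : ℕ, 1 ≤ N → IsFreeEnergyBranch (μ N) (A N) (B N) r (F N)) :
    ∀ K : Set ℂ, K ⊆ Metric.ball 0 r → IsCompact K →
      TendstoUniformlyOn (fun N z => F N z) (C0fun Φ Ψ) Filter.atTop K := by
  intro K hK hKc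
  have hr0 : 0 < r := by
    rw [hr]
    exact lt_min hR (by positivity)
  have hinv : ∀ N, (μ N).IsMulLeftInvariant := fun N => (hμ N).toIsMulLeftInvariant
  refine tendstoUniformlyOn_of_tendsto_coeff (m := r * M ^ 2) hr0 (by positivity) F ?_
    (fun n => Cseq 0 (n + 1) Φ Ψ)
    (fun n => tendsto_iteratedDeriv_freeEnergy hAmom hBmom μ r hr0 F hF n) K hK hKc
  filter_upwards [Filter.eventually_ge_atTop 1] with N hN
  refine ⟨(hF N hN).1, (hF N hN).2.1, fun z hz => ?_⟩
  refine (re_freeEnergy_le hN (μ N) (A N) (B N) M hM.le (hAbd N) (hBbd N) r (F N) (hF N hN) z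
    hz).trans ?_
  have : ‖z‖ ≤ r := by simpa using (Metric.mem_ball.1 hz).le
  gcongr

end HCIZ
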